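/- arXiv:1008.4054 — 3 statements merged into one kernel-verified Lean document; each statement's English description precedes it below -/
import Mathlib

section
/- Let G be a finite group and k a field of characteristic 0 that is a splitting field for G. For every irreducible kG-module V (i.e., End_{kG}(V) ≅ k), the dimension dim_k V divides the order |G|. (Frobenius' theorem.) -/
lemma aux_trace_integral_closed {K : Type*} [Field K] [IsAlgClosed K] {n : Type*} [Fintype n]
    [DecidableEq n] (A : Matrix n n K) (N : ℕ) (hN : 0 < N) (hA : A ^ N = 1) :
    IsIntegral ℤ A.trace := by
  rw [Matrix.trace_eq_sum_roots_charpoly]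
  refine IsIntegral.multiset_sum fun x hx => ?_
  have h1 : x ∈ spectrum K A := Matrix.mem_spectrum_iff_isRoot_charpoly.2
    (Polynomial.isRoot_of_mem_roots hx)
  have h2 := spectrum.pow_mem_pow A N h1
  rw [hA] at h2
  cases isEmpty_or_nonempty n
  · simp [Matrix.charpoly] at hx
  · rw [spectrum.one_eq] at h2
    exact IsIntegral.of_pow hN (by rw [Set.mem_singleton_iff.1 h2]; exact isIntegral_one)

lemma aux_trace_integral {k : Type*} [Field k] {V : Type*} [AddCommGroup V] [Module k V]
    [Module.Finite k V] (f : Module.End k V) (N : ℕ) (hN : 0 < N) (hf : f ^ N = 1) :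
    IsIntegral ℤ (LinearMap.trace k V f) := by
  classical
  let b := Module.finBasis k V
  rw [LinearMap.trace_eq_matrix_trace k b]
  let φ := algebraMap k (AlgebraicClosure k)
  have hinj : Function.Injective φ := φ.injective
  rw [← isIntegral_algHom_iff (φ.toIntAlgHom) hinj]
  have := aux_trace_integral_closed (φ.mapMatrix (LinearMap.toMatrix b b f)) N hN (by
    rw [← map_pow, LinearMap.toMatrix_pow, hf]; simp)
  simpa [Matrix.trace, map_sum] using this

lemma aux_rep {k : Type*} [Field k] [CharZero k] {G : Type*} [Group G] [Fintype G]
    {V : Type*} [AddCommGroup V] [Module k V] [Module.Finite k V] [Nontrivial V]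
    (ρ : Representation k G V)
    (h : ∀ T : Module.End k V, (∀ g, T * ρ g = ρ g * T) → ∃ c : k, T = c • 1) :
    Module.finrank k V ∣ Fintype.card G := by
  classical
  have hchi : ∀ g, IsIntegral ℤ (ρ.character g) := fun g =>
    aux_trace_integral (ρ g) (Fintype.card G) Fintype.card_pos
      (by rw [← map_pow, pow_card_eq_one, map_one])
  have hn0 : (Module.finrank k V : k) ≠ 0 := by
    exact_mod_cast (Module.finrank_pos (R := k) (M := V)).ne'
  have hG0 : (Nat.card G : k) ≠ 0 := by
    exact_mod_cast Nat.card_pos.ne'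
  letI : Invertible (Nat.card G : k) := invertibleOfNonzero hG0
  -- orthogonality
  have hfin : Module.finrank k (Representation.IntertwiningMap ρ ρ) = 1 := by
    refine finrank_eq_one (Representation.IntertwiningMap.id ρ) ?_ ?_
    · intro h0
      obtain ⟨v, hv⟩ := exists_ne (0 : V)
      exact hv (by simpa using congrArg (fun f : Representation.IntertwiningMap ρ ρ => f v) h0)
    · intro f
      obtain ⟨c, hc⟩ := h f.toLinearMap (fun g => f.isIntertwining' g)
      refine ⟨c, ?_⟩
      ext v
      simpa using (LinearMap.congr_fun hc v).symm
  have horth := Representation.card_inv_mul_sum_char_mul_char_eq_finrank ρ ρ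
  rw [hfin, Nat.cast_one, inv_mul_eq_iff_eq_mul₀ hG0, mul_one] at horth
  -- the central element
  obtain ⟨c, hc⟩ := h (∑ g : G, ρ.character g⁻¹ • ρ g) (by
    intro x
    rw [Finset.sum_mul, Finset.mul_sum]
    refine Fintype.sum_equiv (MulAut.conj x⁻¹).toEquiv _ _ (fun g => ?_)
    simp only [MulEquiv.toEquiv_eq_coe, MulEquiv.coe_toEquiv, MulAut.conj_apply, inv_inv]
    rw [smul_mul_assoc, mul_smul_comm, ← map_mul, ← map_mul]
    congr 1
    · rw [show (x⁻¹ * g * x)⁻¹ = x⁻¹ * g⁻¹ * x⁻¹⁻¹ by group, Representation.char_conj]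
    · congr 1; group)
  have hcn : c * Module.finrank k V = Fintype.card G := by
    have := congrArg (LinearMap.trace k V) hc
    simp only [map_sum, map_smul, LinearMap.trace_one, smul_eq_mul] at this
    rw [← this, ← Nat.card_eq_fintype_card, ← horth]
    exact Finset.sum_congr rfl fun g _ => mul_comm _ _
  let O := integralClosure ℤ k
  let F : MonoidAlgebra O G →ₐ[O] Module.End k V := MonoidAlgebra.lift O (Module.End k V) G ρ
  let z : MonoidAlgebra O G := ∑ g : G, MonoidAlgebra.single g (⟨ρ.character g⁻¹, hchi _⟩ : O)
  have hFz : F z = algebraMap k (Module.End k V) c := by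
    rw [Algebra.algebraMap_eq_smul_one, ← hc]
    simp only [F, z, map_sum, MonoidAlgebra.lift_single]
    rfl
  have : Module.Finite O (MonoidAlgebra O G) :=
    Module.Finite.equiv (MonoidAlgebra.coeffLinearEquiv O).symm
  have hz : IsIntegral O (F z) := (Algebra.IsIntegral.isIntegral z).map F
  rw [hFz] at hz
  have hcO : IsIntegral O c := (isIntegral_algebraMap_iff
    (FaithfulSMul.algebraMap_injective k (Module.End k V))).1 hz
  have hcZ : IsIntegral ℤ c := isIntegral_trans c hcO
  have hq : c = algebraMap ℚ k ((Fintype.card G : ℚ) / Module.finrank k V) := by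
    simp only [map_div₀, map_natCast]
    rw [eq_div_iff hn0, hcn]
  rw [hq, isIntegral_algebraMap_iff (algebraMap ℚ k).injective] at hcZ
  obtain ⟨m, hm⟩ := IsIntegrallyClosed.isIntegral_iff.1 hcZ
  have hnQ : (Module.finrank k V : ℚ) ≠ 0 := by exact_mod_cast (by exact_mod_cast hn0)
  rw [eq_div_iff hnQ] at hm
  have : m * (Module.finrank k V : ℤ) = (Fintype.card G : ℤ) := by
    simp only [eq_intCast] at hm
    exact_mod_cast hm
  exact Int.natCast_dvd_natCast.1 ⟨m, by rw [← this, mul_comm]⟩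

/-- Frobenius' theorem: let `k` be a field of characteristic `0` and `G` a finite group.
For every finite-dimensional `kG`-module `V` with `End_{kG}(V) ≅ k`
(absolute irreducibility; automatic for irreducible `V` when `k` is a splitting field),
`dim_k V` divides `|G|`. -/
theorem stmt_17 (k : Type*) [Field k] [CharZero k] (G : Type*) [Group G] [Fintype G]
    (V : Type*) [AddCommGroup V] [Module k V] [Module (MonoidAlgebra k G) V]
    [IsScalarTower k (MonoidAlgebra k G) V] [SMulCommClass k (MonoidAlgebra k G) V]
    [Module.Finite k V]
    (hEnd : Function.Bijective
      fun c : k => (c • LinearMap.id : V →ₗ[MonoidAlgebra k G] V)) :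
    Module.finrank k V ∣ Fintype.card G := by
  have : Nontrivial V := by
    by_contra hV
    rw [not_nontrivial_iff_subsingleton] at hV
    exact zero_ne_one (hEnd.1 (by ext v; exact Subsingleton.elim _ _) : (0 : k) = 1)
  refine aux_rep (Representation.ofModule' (k := k) (G := G) V) (fun T hT => ?_)
  have hT' : ∀ (g : G) (v : V), T (MonoidAlgebra.single g (1 : k) • v)
      = MonoidAlgebra.single g (1 : k) • T v := fun g v => by
    simpa [Representation.ofModule'] using LinearMap.congr_fun (hT g) v
  let T' : V →ₗ[MonoidAlgebra k G] V :=
    { toFun := T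
      map_add' := T.map_add
      map_smul' := fun r v => by
        simp only [RingHom.id_apply]
        induction r using MonoidAlgebra.induction_linear with
        | zero => simp
        | add a b ha hb => simp only [add_smul, map_add, ha, hb]
        | single g r =>
          have : MonoidAlgebra.single g r = r • MonoidAlgebra.single g (1 : k) := by simp
          rw [this, smul_assoc, smul_assoc, map_smul, hT'] }
  obtain ⟨c, hc⟩ := hEnd.2 T'
  refine ⟨c, ?_⟩
  ext v
  exact (LinearMap.congr_fun hc v).symm
end

section
/- Let H be a split semisimple Hopf algebra over a field k of characteristic 0, and let the adjoint class z = Σ_{V ∈ Irr H} [V][V*] = [H_ad] in the center of the Grothendieck ring G_0(H). Then every eigenvalue of the ℤ-linear map x ↦ zx on G_0(H) is a positive integer at most dim_k H; moreover the largest eigenvalue equals dim_k H. If G_0(H) is commutative, every eigenvalue divides dim_k H. -/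
open Finset TensorProduct

/-- The convolution product on the dual of a coalgebra:
`(f * g)(a) = ∑ f(a₁) g(a₂)`. -/
noncomputable def conv (k : Type*) (H : Type*) [CommSemiring k] [AddCommMonoid H]
    [Module k H] [Coalgebra k H] (f g : Module.Dual k H) : Module.Dual k H :=
  (LinearMap.mul' k k).comp ((TensorProduct.map f g).comp (Coalgebra.comul (R := k)))

open Finset TensorProduct
namespace HopfAux
open Coalgebra HopfAlgebra WithConv

section A
variable {k H : Type*} [Field k] [Ring H] [HopfAlgebra k H]

local notation "S" => HopfAlgebra.antipode (A := H) k
local notation "Δ" => Coalgebra.comul (R := k) (A := H)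

/-- left contraction `h ↦ f(h₁) h₂`. -/
noncomputable def P (f : Module.Dual k H) : H →ₗ[k] H :=
  (TensorProduct.lid k H).toLinearMap ∘ₗ (f.rTensor H) ∘ₗ Coalgebra.comul

lemma P_repr (f : Module.Dual k H) {a : H} {ι : Type*} (r : Coalgebra.Repr k a ι) :
    P f a = ∑ i ∈ r.index, f (r.left i) • r.right i := by
  simp [P, ← r.eq]

lemma conv_repr (f g : Module.Dual k H) {a : H} {ι : Type*} (r : Coalgebra.Repr k a ι) :
    conv k H f g a = ∑ i ∈ r.index, f (r.left i) * g (r.right i) := by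
  simp [conv, ← r.eq]

lemma conv_apply (f g : Module.Dual k H) (a : H) : conv k H f g a = g (P f a) := by
  rw [conv_repr f g (ℛ k a), P_repr f (ℛ k a)]; simp

lemma conv_eq (f g : Module.Dual k H) : conv k H f g = (toConv f * toConv g).ofConv := by
  rfl

lemma conv_assoc (f g h : Module.Dual k H) :
    conv k H (conv k H f g) h = conv k H f (conv k H g h) := by
  simp only [conv_eq, toConv_ofConv, mul_assoc]

lemma conv_sum_left {ι : Type*} (s : Finset ι) (f : ι → Module.Dual k H) (g : Module.Dual k H) :
    conv k H (∑ i ∈ s, f i) g = ∑ i ∈ s, conv k H (f i) g := by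
  ext a
  simp [conv_repr _ _ (ℛ k a), LinearMap.sum_apply, Finset.sum_mul]
  rw [Finset.sum_comm]

lemma conv_sum_right {ι : Type*} (s : Finset ι) (f : ι → Module.Dual k H) (g : Module.Dual k H) :
    conv k H g (∑ i ∈ s, f i) = ∑ i ∈ s, conv k H g (f i) := by
  ext a
  simp [conv_apply, LinearMap.sum_apply]

lemma conv_smul_left (c : k) (f g : Module.Dual k H) :
    conv k H (c • f) g = c • conv k H f g := by
  ext a
  simp [conv_repr _ _ (ℛ k a), Finset.mul_sum, mul_assoc]

lemma conv_smul_right (c : k) (f g : Module.Dual k H) :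
    conv k H g (c • f) = c • conv k H g f := by
  ext a
  simp [conv_apply]

lemma conv_one_apply (f g : Module.Dual k H) : conv k H f g 1 = f 1 * g 1 := by
  simp [conv, Algebra.TensorProduct.one_def]

lemma conv_counit_left (f : Module.Dual k H) : conv k H (counit (R := k) (A := H)) f = f := by
  ext a
  rw [conv_repr _ _ (ℛ k a)]
  have := congrArg f (sum_counit_smul (ℛ k a))
  simpa using this

lemma conv_counit_right (f : Module.Dual k H) : conv k H f (counit (R := k) (A := H)) = f := by
  rw [conv_eq]
  have : (toConv (counit (R := k) (A := H)) : WithConv (H →ₗ[k] k)) = 1 := rfl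
  rw [this, mul_one]

lemma P_smul (c : k) (f : Module.Dual k H) : P (c • f) = c • P f := by
  ext a; simp [P_repr _ (ℛ k a), Finset.smul_sum, mul_smul]

lemma P_sum {ι : Type*} (s : Finset ι) (f : ι → Module.Dual k H) :
    P (∑ i ∈ s, f i) = ∑ i ∈ s, P (f i) := by
  ext a
  simp [P_repr _ (ℛ k a), LinearMap.sum_apply, Finset.sum_smul]
  rw [Finset.sum_comm]

lemma dual_ext {x y : H} (h : ∀ f : Module.Dual k H, f x = f y) : x = y := by
  rw [← sub_eq_zero]
  refine (Module.forall_dual_apply_eq_zero_iff k (x - y)).1 fun f => ?_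
  rw [map_sub, h f, sub_self]

lemma P_conv (f g : Module.Dual k H) : P (conv k H f g) = P g ∘ₗ P f := by
  ext a
  refine dual_ext (k := k) fun φ => ?_
  rw [← conv_apply, conv_assoc, conv_apply, conv_apply]
  rfl

lemma P_counit : P (counit (R := k) (A := H)) = LinearMap.id := by
  ext a
  refine dual_ext (k := k) fun φ => ?_
  rw [← conv_apply, conv_counit_left]; rfl

/-- Coassociativity in contracted form. -/
lemma comul_P (f : Module.Dual k H) (a : H) :
    Δ (P f a) = (P f).rTensor H (Δ a) := by
  have h := (coassoc_apply (R := k) a).symm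
  have h2 := congrArg ((TensorProduct.lid k (H ⊗[k] H)).toLinearMap ∘ₗ f.rTensor (H ⊗[k] H)) h
  have e1 : ((TensorProduct.lid k (H ⊗[k] H)).toLinearMap ∘ₗ f.rTensor (H ⊗[k] H))
      ((Δ).lTensor H (Δ a)) = Δ (P f a) := by
    simp [P, ← (ℛ k a).eq]
  have e2 : ∀ x : H ⊗[k] H, ((TensorProduct.lid k (H ⊗[k] H)).toLinearMap ∘ₗ f.rTensor (H ⊗[k] H))
      (TensorProduct.assoc k H H H ((Δ).rTensor H x)) = (P f).rTensor H x := by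
    intro x
    induction x with
    | zero => simp
    | add x y hx hy => simp only [map_add, hx, hy]
    | tmul x y =>
      rw [LinearMap.rTensor_tmul, LinearMap.rTensor_tmul, P_repr f (ℛ k x), ← (ℛ k x).eq]
      simp [TensorProduct.sum_tmul, TensorProduct.smul_tmul']
  rw [← e1, ← e2, h2]

/-- The antipode is an anti-coalgebra map, and consequences. -/
lemma comul_antipode (a : H) :
    Δ (S a) = TensorProduct.map S S (TensorProduct.comm k H H (Δ a)) := by
  let i1 : H →ₐ[k] H ⊗[k] H := Algebra.TensorProduct.includeLeft
  let i2 : H →ₐ[k] H ⊗[k] H := Algebra.TensorProduct.includeRight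
  have hd : (toConv (Δ) : WithConv (H →ₗ[k] H ⊗[k] H)) =
      toConv i1.toLinearMap * toConv i2.toLinearMap := by
    ext c
    rw [(ℛ k c).convMul_apply]
    simp [i1, i2, (ℛ k c).eq]
  have hG : (toConv (TensorProduct.map S S ∘ₗ (TensorProduct.comm k H H).toLinearMap ∘ₗ Δ) :
      WithConv (H →ₗ[k] H ⊗[k] H)) =
      toConv (i2.toLinearMap ∘ₗ S) * toConv (i1.toLinearMap ∘ₗ S) := by
    ext c
    rw [(ℛ k c).convMul_apply]
    simp [i1, i2, ← (ℛ k c).eq]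
  have h1 : ∀ i : H →ₐ[k] H ⊗[k] H, (toConv (i.toLinearMap ∘ₗ S) : WithConv (H →ₗ[k] H ⊗[k] H)) *
      toConv i.toLinearMap = 1 := by
    intro i
    ext c
    rw [(ℛ k c).convMul_apply]
    have := congrArg i (sum_antipode_mul_eq_algebraMap_counit (R := k) (ℛ k c))
    simpa using this
  have hl : (toConv (TensorProduct.map S S ∘ₗ (TensorProduct.comm k H H).toLinearMap ∘ₗ Δ) :
      WithConv (H →ₗ[k] H ⊗[k] H)) * toConv (Δ) = 1 := by
    rw [hG, hd, mul_assoc, ← mul_assoc _ (toConv i1.toLinearMap), h1 i1, one_mul, h1 i2]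
  have := left_inv_eq_right_inv hl (LinearMap.comul_right_inv (R := k) (C := H))
  have h3 := congrArg (fun f => f.ofConv a) this
  simpa using h3.symm

lemma conv_antipode (f g : Module.Dual k H) (a : H) :
    conv k H f g (S a) = conv k H (g ∘ₗ S) (f ∘ₗ S) a := by
  simp only [conv, LinearMap.comp_apply, comul_antipode]
  simp [← (ℛ k a).eq, mul_comm]

lemma comul_antipode_sq (a : H) :
    Δ (S (S a)) = TensorProduct.map (S ∘ₗ S) (S ∘ₗ S) (Δ a) := by
  rw [comul_antipode, comul_antipode]
  simp [← (ℛ k a).eq]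

end A
end HopfAux

open Finset TensorProduct
namespace HopfAux
open Coalgebra HopfAlgebra WithConv

section B
variable {k H : Type*} [Field k] [Ring H] [HopfAlgebra k H]

local notation "S" => HopfAlgebra.antipode (A := H) k
local notation "Δ" => Coalgebra.comul (R := k) (A := H)
local notation "ε" => Coalgebra.counit (R := k) (A := H)

variable {L : H}

lemma counit_P (f : Module.Dual k H) (a : H) : ε (P f a) = f a := by
  rw [← conv_apply, conv_counit_right]

/-- `Λ₁ a ⊗ Λ₂ = Λ₁ ⊗ Λ₂ S(a)`. -/
lemma int_right (hR : ∀ h : H, L * h = ε h • L) (a : H) :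
    Δ L * (a ⊗ₜ[k] (1 : H)) = Δ L * ((1 : H) ⊗ₜ[k] S a) := by
  let i1 : H →ₐ[k] H ⊗[k] H := Algebra.TensorProduct.includeLeft
  let i2 : H →ₐ[k] H ⊗[k] H := Algebra.TensorProduct.includeRight
  have hd : (toConv (Δ) : WithConv (H →ₗ[k] H ⊗[k] H)) =
      toConv i1.toLinearMap * toConv i2.toLinearMap := by
    ext c
    rw [(ℛ k c).convMul_apply]
    simp [i1, i2, (ℛ k c).eq]
  have h1 : toConv i2.toLinearMap * (toConv (i2.toLinearMap ∘ₗ S) :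
      WithConv (H →ₗ[k] H ⊗[k] H)) = 1 := by
    ext c
    rw [(ℛ k c).convMul_apply]
    have := congrArg i2 (sum_mul_antipode_eq_algebraMap_counit (R := k) (ℛ k c))
    simpa using this
  have h2 : (toConv i1.toLinearMap : WithConv (H →ₗ[k] H ⊗[k] H)) =
      toConv (Δ) * toConv (i2.toLinearMap ∘ₗ S) := by
    rw [hd, mul_assoc, h1, mul_one]
  have h3 := congrArg (fun f => f.ofConv a) h2
  have h4 : i1 a = ∑ i ∈ (ℛ k a).index, Δ ((ℛ k a).left i) * i2 (S ((ℛ k a).right i)) := by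
    have h5 := h3.trans ((ℛ k a).convMul_apply _ _)
    simpa using h5
  have h6 : (a ⊗ₜ[k] (1 : H)) = i1 a := rfl
  have h7 : ((1 : H) ⊗ₜ[k] S a) = i2 (S a) := rfl
  rw [h6, h7, h4, Finset.mul_sum]
  conv_rhs => rw [← sum_counit_smul (ℛ k a)]
  simp only [map_sum, Finset.mul_sum, map_smul]
  refine Finset.sum_congr rfl fun i _ => ?_
  rw [← mul_assoc, ← Bialgebra.comul_mul, hR, map_smul]
  simp

/-- `a Λ₁ ⊗ S(Λ₂) = Λ₁ ⊗ S(Λ₂) a`. -/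
lemma int_left (hL : ∀ h : H, h * L = ε h • L) (a : H) :
    (a ⊗ₜ[k] (1 : H)) * (S).lTensor H (Δ L) = (S).lTensor H (Δ L) * ((1 : H) ⊗ₜ[k] a) := by
  let i1 : H →ₐ[k] H ⊗[k] H := Algebra.TensorProduct.includeLeft
  let i2 : H →ₐ[k] H ⊗[k] H := Algebra.TensorProduct.includeRight
  let r := ℛ k L
  let Om : H ⊗[k] H →ₗ[k] H ⊗[k] H := ∑ s ∈ r.index,
    TensorProduct.map (LinearMap.mulRight k (r.left s)) (LinearMap.mulLeft k (S (r.right s)))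
  have hOm1 : Om 1 = (S).lTensor H (Δ L) := by
    simp [Om, LinearMap.sum_apply, Algebra.TensorProduct.one_def, ← r.eq]
  have hOmr : ∀ w b, Om (w * i2 b) = Om w * i2 b := by
    intro w b
    induction w with
    | zero => simp
    | add x y hx hy => simp only [map_add, add_mul, hx, hy]
    | tmul x y => simp [Om, i2, LinearMap.sum_apply, Finset.sum_mul, mul_assoc]
  have hOmi : Om (i1 a) = (a ⊗ₜ[k] (1 : H)) * (S).lTensor H (Δ L) := by
    simp [Om, i1, LinearMap.sum_apply, ← r.eq, Finset.mul_sum]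
  let ze : WithConv (H →ₗ[k] H ⊗[k] H) := toConv i1.toLinearMap * toConv (i2.toLinearMap ∘ₗ S)
  have hze : ∀ b, Om (ze.ofConv b) = ε b • Om 1 := by
    intro b
    have h5 := (ℛ k b).convMul_apply (toConv i1.toLinearMap)
      (toConv (i2.toLinearMap ∘ₗ S) : WithConv (H →ₗ[k] H ⊗[k] H))
    have : ze.ofConv b = ∑ i ∈ (ℛ k b).index, (ℛ k b).left i ⊗ₜ[k] S ((ℛ k b).right i) := by
      refine h5.trans ?_
      simp [i1, i2]
    rw [this, hOm1]
    have h6 : (S).lTensor H (Δ (b * L)) = ε b • (S).lTensor H (Δ L) := by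
      rw [hL, map_smul, map_smul]
    rw [← h6, Bialgebra.comul_mul, ← r.eq, ← (ℛ k b).eq]
    simp only [Om, LinearMap.sum_apply, map_sum, TensorProduct.map_tmul, Finset.sum_mul,
      Finset.mul_sum, Algebra.TensorProduct.tmul_mul_tmul, LinearMap.lTensor_tmul,
      antipode_mul_antidistrib, LinearMap.mulRight_apply, LinearMap.mulLeft_apply]
    exact Finset.sum_comm
  have h1 : (toConv (i2.toLinearMap ∘ₗ S) : WithConv (H →ₗ[k] H ⊗[k] H)) *
      toConv i2.toLinearMap = 1 := by
    ext c
    rw [(ℛ k c).convMul_apply]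
    have := congrArg i2 (sum_antipode_mul_eq_algebraMap_counit (R := k) (ℛ k c))
    simpa using this
  have h2 : (toConv i1.toLinearMap : WithConv (H →ₗ[k] H ⊗[k] H)) =
      ze * toConv i2.toLinearMap := by
    rw [mul_assoc, h1, mul_one]
  have h3 := congrArg (fun f => f.ofConv a) h2
  have h4 : i1 a = ∑ i ∈ (ℛ k a).index, ze.ofConv ((ℛ k a).left i) * i2 ((ℛ k a).right i) := by
    have h5 := h3.trans ((ℛ k a).convMul_apply _ _)
    simpa using h5
  rw [← hOmi, h4, map_sum, ← hOm1]
  have h7 : ((1 : H) ⊗ₜ[k] a) = i2 a := rfl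
  rw [h7]
  conv_rhs => rw [← sum_counit_smul (ℛ k a)]
  simp only [hOmr, hze, map_sum, map_smul, Finset.mul_sum]
  refine Finset.sum_congr rfl fun i _ => ?_
  simp

/-- Contracted forms. -/
lemma J_right (hR : ∀ h : H, L * h = ε h • L) (f : Module.Dual k H) (a : H) :
    P (f ∘ₗ LinearMap.mulRight k a) L = P f L * S a := by
  have := congrArg (fun x => TensorProduct.lid k H (f.rTensor H x)) (int_right hR a)
  simp only [← (ℛ k L).eq, Finset.sum_mul, map_sum] at this
  rw [P_repr _ (ℛ k L), P_repr _ (ℛ k L)]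
  simpa [Finset.sum_mul] using this

lemma J_left (hL : ∀ h : H, h * L = ε h • L) (f : Module.Dual k H) (a : H) :
    S (P (f ∘ₗ LinearMap.mulLeft k a) L) = S (P f L) * a := by
  have := congrArg (fun x => TensorProduct.lid k H (f.rTensor H x)) (int_left hL a)
  simp only [← (ℛ k L).eq, Finset.sum_mul, Finset.mul_sum, map_sum, LinearMap.lTensor_tmul] at this
  rw [P_repr _ (ℛ k L), P_repr _ (ℛ k L)]
  simpa [Finset.sum_mul] using this

end B
end HopfAux

open Finset TensorProduct
set_option linter.unusedSectionVars false
set_option linter.unusedSimpArgs false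
set_option linter.unusedVariables false
namespace HopfAux
open Coalgebra HopfAlgebra WithConv

section C
variable {k H : Type*} [Field k] [Ring H] [Algebra k H]
  {ι : Type*} [Fintype ι] [DecidableEq ι] {d : ι → ℕ}
  (W : H ≃ₐ[k] ((i : ι) → Matrix (Fin (d i)) (Fin (d i)) k))

/-- matrix units -/
noncomputable def E (i : ι) (a b : Fin (d i)) : H := W.symm (Pi.single i (Matrix.single a b 1))
/-- block idempotents -/
noncomputable def e (i : ι) : H := W.symm (Pi.single i 1)
/-- irreducible characters -/
noncomputable def ch (i : ι) : Module.Dual k H :=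
  (Matrix.traceLinearMap (Fin (d i)) k k).comp ((LinearMap.proj i).comp W.toLinearMap)
/-- sum of irreducible characters -/
noncomputable def th : Module.Dual k H := ∑ i, ch W i

lemma ch_apply (i : ι) (x : H) : ch W i x = Matrix.trace (W x i) := rfl
lemma th_apply (x : H) : th W x = ∑ i, ch W i x := by simp [th]

lemma ch_comm (i : ι) (x y : H) : ch W i (x * y) = ch W i (y * x) := by
  simp only [ch_apply, map_mul, Pi.mul_apply]; exact Matrix.trace_mul_comm _ _

lemma th_comm (x y : H) : th W (x * y) = th W (y * x) := by
  simp only [th_apply, ch_comm W _ x y]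

lemma e_comm (i : ι) (x : H) : e W i * x = x * e W i := by
  apply W.injective
  ext j : 1
  by_cases h : j = i
  · subst h; simp [e]
  · simp [e, h]

lemma W_e (i j : ι) : W (e W i) j = if j = i then 1 else 0 := by
  by_cases h : j = i
  · subst h; simp [e]
  · simp [e, h]

lemma ch_e_mul (i j : ι) (x : H) : ch W i (e W j * x) = if i = j then ch W i x else 0 := by
  simp only [ch_apply, map_mul, Pi.mul_apply, W_e]
  split_ifs <;> simp

lemma th_e_mul (i : ι) (x : H) : th W (e W i * x) = ch W i x := by
  simp [th_apply, ch_e_mul]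

lemma e_mul_e (i j : ι) : e W i * e W j = if i = j then e W i else 0 := by
  apply W.injective
  ext l : 1
  by_cases h : i = j
  · subst h; by_cases h1 : l = i <;> simp [W_e, h1]
  · simp only [map_mul, Pi.mul_apply, W_e, h, if_false, map_zero, Pi.zero_apply]
    by_cases h1 : l = i
    · subst h1; simp [h]
    · simp [h1]

lemma sum_e : ∑ i, e W i = 1 := by
  apply W.injective
  ext j : 1
  simp [W_e, Finset.sum_apply]

lemma ch_one (i : ι) : ch W i 1 = d i := by simp [ch_apply]
lemma ch_e (i j : ι) : ch W i (e W j) = if i = j then (d i : k) else 0 := by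
  have := ch_e_mul W i j 1
  simpa [ch_one] using this

lemma W_E (i : ι) (a b : Fin (d i)) (j : ι) :
    W (E W i a b) j = (Pi.single i (Matrix.single a b 1) :
      (i : ι) → Matrix (Fin (d i)) (Fin (d i)) k) j := by
  simp [E]

lemma W_E_same (i : ι) (a b : Fin (d i)) : W (E W i a b) i = Matrix.single a b 1 := by
  simp [E]

lemma th_mul_E (x : H) (i : ι) (a b : Fin (d i)) : th W (x * E W i a b) = W x i b a := by
  rw [th_apply, Finset.sum_eq_single i]
  · simp [ch_apply, W_E_same, Matrix.trace_mul_single]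
  · intro j _ h
    simp [ch_apply, W_E, h]
  · simp

lemma th_nondeg {b : H} (h : ∀ x, th W (b * x) = 0) : b = 0 := by
  apply W.injective
  ext i p q
  have := h (E W i q p)
  rw [th_mul_E] at this
  simpa using this

lemma sum_E (x : H) : x = ∑ i, ∑ a, ∑ b, W x i a b • E W i a b := by
  apply W.injective
  ext i p q
  simp only [map_sum, Finset.sum_apply, map_smul, Pi.smul_apply, Matrix.sum_apply]
  rw [Finset.sum_eq_single i]
  · simp [W_E_same, Matrix.single, Finset.sum_ite, ite_and, Finset.filter_eq']
  · intro j _ h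
    simp [W_E, Pi.single_eq_of_ne' h]
  · simp

lemma th_surj (f : Module.Dual k H) : ∃ b : H, ∀ x, f x = th W (b * x) := by
  refine ⟨∑ i, ∑ a, ∑ b, f (E W i a b) • E W i b a, fun x => ?_⟩
  conv_lhs => rw [sum_E W x]
  simp only [map_sum, Finset.sum_mul, map_smul, smul_mul_assoc, th_comm W (E W _ _ _) x, th_mul_E,
    smul_eq_mul, mul_comm]

lemma th_ext {b c : H} (h : ∀ x, th W (b * x) = th W (c * x)) : b = c := by
  rw [← sub_eq_zero]
  apply th_nondeg W
  intro x
  rw [sub_mul, map_sub, h, sub_self]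

lemma central_form {b : H} (h : ∀ x, b * x = x * b) : ∃ c : ι → k, b = ∑ i, c i • e W i := by
  have : ∀ i, ∃ c : k, W b i = c • 1 := by
    intro i
    have h1 : W b i ∈ Set.range (Matrix.scalar (α := k) (Fin (d i))) := by
      rw [Matrix.mem_range_scalar_iff_commute_single']
      intro a b'
      have := congrArg (fun z => W z i) (h (E W i a b'))
      simp only [map_mul, Pi.mul_apply, W_E_same] at this
      exact this.symm
    obtain ⟨c, hc⟩ := h1
    exact ⟨c, by rw [← hc]; simp [Matrix.smul_one_eq_diagonal]⟩
  choose c hc using this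
  refine ⟨c, W.injective ?_⟩
  ext i : 1
  simp [Finset.sum_apply, W_e, hc]

lemma e_mul_form (c : ι → k) (j : ι) : (∑ i, c i • e W i) * e W j = c j • e W j := by
  simp [Finset.sum_mul, e_mul_e]

lemma ch_mul_form (c : ι → k) (j : ι) (x : H) : ch W j ((∑ i, c i • e W i) * x) = c j * ch W j x := by
  simp [Finset.sum_mul, ch_e_mul]

lemma trace_form {f : Module.Dual k H} (h : ∀ a b, f (a * b) = f (b * a)) :
    ∃ c : ι → k, f = ∑ i, c i • ch W i := by
  obtain ⟨b, hb⟩ := th_surj W f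
  have : ∀ x, b * x = x * b := by
    intro x
    apply th_ext W
    intro z
    rw [mul_assoc, ← hb, h, hb, ← mul_assoc, th_comm, mul_assoc]
  obtain ⟨c, hc⟩ := central_form W this
  refine ⟨c, ?_⟩
  ext x
  rw [hb, hc]
  simp [Finset.sum_mul, th_e_mul]

lemma exists_ideal {b : H} (hb : b ≠ 0) : ∃ i, ∃ u : k, u ≠ 0 ∧ ∃ p q, ∀ r,
    E W i r p * b * E W i q r = u • E W i r r := by
  have : ∃ i p q, W b i p q ≠ 0 := by
    by_contra! hc
    exact hb (W.injective (by ext i p q; simp [hc]))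
  obtain ⟨i, p, q, h⟩ := this
  refine ⟨i, _, h, p, q, fun r => ?_⟩
  apply W.injective
  ext j : 1
  by_cases hj : j = i
  · subst hj
    simp [W_E_same, Matrix.single_mul_mul_single]
  · simp [W_E, hj]

lemma sum_E_diag (i : ι) : ∑ r, E W i r r = e W i := by
  apply W.injective
  ext j : 1
  by_cases hj : j = i
  · subst hj
    simp only [map_sum, Finset.sum_apply, W_E_same, W_e]
    ext a b
    simp [Matrix.sum_apply, Matrix.single, Matrix.one_apply, ite_and]
  · simp [W_E, W_e, hj, Finset.sum_apply]

/-- the standard basis -/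
noncomputable def bas : Module.Basis (Σ i, Fin (d i) × Fin (d i)) k H :=
  (Pi.basis fun i => Matrix.stdBasis k (Fin (d i)) (Fin (d i))).map W.toLinearEquiv.symm

lemma bas_apply (p : Σ i, Fin (d i) × Fin (d i)) : bas W p = E W p.1 p.2.1 p.2.2 := by
  simp only [bas, E, Pi.basis_apply, Module.Basis.map_apply]
  rw [← Matrix.stdBasis_eq_single]; rfl

lemma bas_repr (x : H) (p : Σ i, Fin (d i) × Fin (d i)) :
    (bas W).repr x p = W x p.1 p.2.1 p.2.2 := by
  simp [bas, Pi.basis_repr, Matrix.stdBasis]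

lemma trace_lr (u v : H) : LinearMap.trace k H (LinearMap.mulLeft k u ∘ₗ LinearMap.mulRight k v) =
    ∑ i, ch W i u * ch W i v := by
  rw [LinearMap.trace_eq_matrix_trace k (bas W), Matrix.trace, Fintype.sum_sigma]
  refine Finset.sum_congr rfl fun i _ => ?_
  rw [Fintype.sum_prod_type]
  simp only [Matrix.diag_apply, LinearMap.toMatrix_apply, bas_repr, bas_apply,
    LinearMap.comp_apply, LinearMap.mulLeft_apply, LinearMap.mulRight_apply, map_mul,
    Pi.mul_apply, W_E_same, ← mul_assoc, ch_apply, Matrix.trace]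
  rw [Finset.sum_mul_sum]
  refine Finset.sum_congr rfl fun a _ => Finset.sum_congr rfl fun b _ => ?_
  simp [Matrix.mul_apply, Matrix.single, ite_and]

lemma finrank_eq (W : H ≃ₐ[k] ((i : ι) → Matrix (Fin (d i)) (Fin (d i)) k)) :
    Module.finrank k H = ∑ i, d i ^ 2 := by
  rw [Module.finrank_eq_card_basis (bas W)]
  simp [Fintype.card_sigma, sq]

lemma ch_li [CharZero k] (hd : ∀ i, 0 < d i) {a b : ι → k} (h : ∑ i, a i • ch W i = ∑ i, b i • ch W i) : a = b := by
  ext j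
  have := congrArg (fun f => f (e W j)) h
  simp [ch_e] at this
  exact this.resolve_right (hd j).ne'

end C
end HopfAux

open Finset TensorProduct
set_option linter.unusedSectionVars false
set_option linter.unusedSimpArgs false
set_option linter.unusedVariables false
namespace HopfAux
open Coalgebra HopfAlgebra WithConv

/-- The data of the theorem. -/
structure SD (k H ι : Type*) [Field k] [Ring H] [HopfAlgebra k H] [Fintype ι]
    [DecidableEq ι] where
  d : ι → ℕ
  hd : ∀ i, 0 < d i
  W : H ≃ₐ[k] ((i : ι) → Matrix (Fin (d i)) (Fin (d i)) k)
  st : ι → ι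
  hst : ∀ i, ch W (st i) = (ch W i).comp (HopfAlgebra.antipode (R := k))
  N : ι → ι → ι → ℕ
  hN : ∀ i j, conv k H (ch W i) (ch W j) = ∑ l, (N i j l : k) • ch W l
  i0 : ι
  h0 : ch W i0 = counit
  hd0 : d i0 = 1

section D
variable {k H ι : Type*} [Field k] [Ring H] [HopfAlgebra k H] [Fintype ι] [DecidableEq ι]

local notation "S" => HopfAlgebra.antipode (A := H) k
local notation "Δ" => Coalgebra.comul (R := k) (A := H)
local notation "ε" => Coalgebra.counit (R := k) (A := H)

lemma exists_i0 [CharZero k] {d : ι → ℕ}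
    (W : H ≃ₐ[k] ((i : ι) → Matrix (Fin (d i)) (Fin (d i)) k)) :
    ∃ i, ch W i = ε ∧ d i = 1 := by
  obtain ⟨c, hc⟩ := trace_form W (f := ε) (by intro a b; simp [mul_comm])
  have h1 : ∑ i, ε (e W i) = 1 := by rw [← map_sum, sum_e]; simp
  have h2 : ∃ i, ε (e W i) ≠ 0 := by
    by_contra! h
    simp [h] at h1
  obtain ⟨i, hi⟩ := h2
  have h3 : ∀ j, j ≠ i → c j = 0 ∨ d j = 0 := by
    intro j hj
    have : ε (e W j * e W i) = 0 := by rw [e_mul_e]; simp [hj]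
    rw [Bialgebra.counit_mul] at this
    have h4 := (mul_eq_zero.1 this).resolve_right hi
    rw [hc] at h4
    simpa [ch_e] using h4
  have h4 : ε = c i • ch W i := by
    rw [hc, Finset.sum_eq_single i _ (by simp)]
    intro j _ hj
    rcases h3 j hj with h | h
    · simp [h]
    · have : ch W j = 0 := by
        ext x
        rw [ch_apply]
        have : IsEmpty (Fin (d j)) := by rw [h]; infer_instance
        simp [Matrix.trace]
      simp [this]
  have hcd : c i * d i = 1 := by
    have := congrArg (fun f => f (1 : H)) h4
    simpa [ch_one] using this.symm
  have hci : c i ≠ 0 := by rintro h; simp [h] at hcd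
  have hEE : ∀ a b, ε (E W i a b) = c i * if a = b then 1 else 0 := by
    intro a b
    rw [h4]
    simp [ch_apply, W_E_same, Matrix.trace_single_eq_of_ne]
    by_cases h : a = b
    · subst h; simp
    · simp [h, Matrix.trace_single_eq_of_ne]
  have hdd : d i = 1 := by
    by_contra hne
    have h5 : d i ≠ 0 := by rintro h; simp [h] at hcd
    let a : Fin (d i) := ⟨0, by omega⟩
    let b : Fin (d i) := ⟨1, by omega⟩
    have hab : a ≠ b := by simp [a, b]
    have h6 : E W i a b * E W i b a = E W i a a := by
      apply W.injective
      ext j : 1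
      by_cases hj : j = i
      · subst hj; simp [W_E_same]
      · simp [W_E, hj]
    have h7 := congrArg (fun x => ε x) h6
    simp [Bialgebra.counit_mul, hEE, hab, hci] at h7
    exact hci h7.symm
  refine ⟨i, ?_, hdd⟩
  rw [h4]
  have : c i = 1 := by simpa [hdd] using hcd
  simp [this]

namespace SD
variable (D : SD k H ι)

/-- the integral -/
noncomputable def L : H := e D.W D.i0
/-- theta -/
noncomputable abbrev t : Module.Dual k H := th D.W
/-- irreducible characters -/
noncomputable abbrev c (i : ι) : Module.Dual k H := ch D.W i
/-- J -/
noncomputable def J (f : Module.Dual k H) : H := P f D.L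
/-- y -/
noncomputable def y : H := S (D.J D.t)

lemma L_left (h : H) : h * D.L = ε h • D.L := by
  apply D.W.injective
  ext j : 1
  by_cases hj : j = D.i0
  · subst hj
    rw [← D.h0, ch_apply]
    have : Subsingleton (Fin (D.d D.i0)) := by rw [D.hd0]; infer_instance
    ext a b
    obtain rfl := Subsingleton.elim a b
    have hu : (Finset.univ : Finset (Fin (D.d D.i0))) = {a} := by
      ext x; simp [Subsingleton.elim x a]
    simp [L, W_e, Matrix.trace, hu]
  · simp [L, W_e, hj]

lemma L_right (h : H) : D.L * h = ε h • D.L := by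
  rw [← D.L_left, L, e_comm]

lemma c_L (i : ι) : D.c i D.L = if i = D.i0 then 1 else 0 := by
  simp only [L, c, ch_e]
  split_ifs with h
  · subst h; simp [D.hd0]
  · rfl

lemma counit_L : ε D.L = 1 := by
  rw [← D.h0]; simpa using D.c_L D.i0

lemma S_J (b : H) : S (D.J (D.t ∘ₗ LinearMap.mulLeft k b)) = D.y * b :=
  J_left D.L_left _ _

lemma S2_y (a : H) : S (S a) * D.y = D.y * a := by
  rw [← D.S_J, y, ← antipode_mul_antidistrib, J, J, ← J_right D.L_right]
  congr 2
  congr 1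
  ext x
  simp [th_comm]

/-- `∑ S(Λ₂) T(Λ₁)` -/
noncomputable def Q (T : H →ₗ[k] H) : H :=
  ∑ i ∈ (ℛ k D.L).index, S ((ℛ k D.L).right i) * T ((ℛ k D.L).left i)

lemma Q_trace [FiniteDimensional k H] (w : H) (T : H →ₗ[k] H) :
    D.t (w * D.Q T) = LinearMap.trace k H (LinearMap.mulRight k (w * D.y) ∘ₗ T) := by
  obtain ⟨x, rfl⟩ := (dualTensorHom_bijective (R := k) (M := H) (N := H)).surjective T
  induction x with
  | zero => simp [Q]
  | add a b ha hb =>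
    have : D.Q (dualTensorHom k H H (a + b)) = D.Q (dualTensorHom k H H a)
        + D.Q (dualTensorHom k H H b) := by
      simp [Q, mul_add, Finset.sum_add_distrib]
    rw [this, mul_add, map_add, ha, hb, map_add, LinearMap.comp_add, map_add]
  | tmul f v =>
    have h1 : LinearMap.mulRight k (w * D.y) ∘ₗ dualTensorHom k H H (f ⊗ₜ v) =
        dualTensorHom k H H (f ⊗ₜ (v * (w * D.y))) := by
      ext x; simp [mul_assoc]
    rw [h1, LinearMap.trace_eq_contract_apply, contractLeft_apply]
    obtain ⟨b, hb⟩ := th_surj D.W f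
    have h2 : D.Q (dualTensorHom k H H (f ⊗ₜ v)) = S (D.J f) * v := by
      rw [Q, J, P_repr _ (ℛ k D.L)]
      simp [Finset.sum_mul]
    have h3 : f = D.t ∘ₗ LinearMap.mulLeft k b := by ext x; simp [hb]
    rw [h2, hb, h3, S_J]
    rw [th_comm _ b]
    simp only [t, mul_assoc]
    rw [th_comm _ v]
    simp only [mul_assoc]

lemma c_y [CharZero k] [FiniteDimensional k H] (i : ι) : D.c i D.y = 1 := by
  have h := D.Q_trace 1 (LinearMap.mulLeft k (e D.W i))
  have h1 : LinearMap.mulRight k (1 * D.y) ∘ₗ LinearMap.mulLeft k (e D.W i) =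
     LinearMap.mulLeft k (e D.W i) ∘ₗ LinearMap.mulRight k D.y := by
    ext x; simp [mul_assoc]
  have h2 : D.t (1 * D.Q (LinearMap.mulLeft k (e D.W i))) = D.d i := by
    have : D.t (1 * D.Q (LinearMap.mulLeft k (e D.W i))) = D.t (e D.W i *
       ∑ j ∈ (ℛ k D.L).index, (ℛ k D.L).left j * S ((ℛ k D.L).right j)) := by
      simp only [Q, one_mul, map_sum, LinearMap.mulLeft_apply, Finset.mul_sum]
      refine Finset.sum_congr rfl fun j _ => ?_
      rw [t, th_comm, mul_assoc]
    rw [this, sum_mul_antipode_eq_algebraMap_counit, counit_L, t, th_e_mul]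
    simp [ch_one]
  rw [h1, trace_lr D.W, h2] at h
  simp [ch_e, D.hd, (D.hd i).ne'] at h
  exact h

lemma y_isUnit [CharZero k] [FiniteDimensional k H] : IsUnit D.y := by
  have hinj : ∀ b, D.y * b = 0 → b = 0 := by
    intro b hb
    by_contra hne
    obtain ⟨i, u, hu, p, q, h⟩ := exists_ideal D.W hne
    have h1 : ∀ r, D.y * E D.W i r r = 0 := by
      intro r
      have : D.y * (u • E D.W i r r) = 0 := by
        rw [← h, ← mul_assoc, ← mul_assoc, ← S2_y, mul_assoc _ D.y, hb]
        simp
      rw [mul_smul_comm] at this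
      exact (smul_eq_zero.1 this).resolve_left hu
    have h2 : D.y * e D.W i = 0 := by
      rw [← sum_E_diag, Finset.mul_sum]
      simp [h1]
    have h3 := D.c_y i
    have h4 := ch_e_mul D.W i i D.y
    rw [e_comm, h2] at h4
    simp at h4
    rw [← h4] at h3
    exact zero_ne_one h3
  have hinj' : Function.Injective (LinearMap.mulLeft k D.y) := by
    rw [← LinearMap.ker_eq_bot, LinearMap.ker_eq_bot']
    exact hinj
  obtain ⟨z, hz⟩ := (LinearMap.injective_iff_surjective.1 hinj') 1
  simp at hz
  refine ⟨⟨D.y, z, hz, ?_⟩, rfl⟩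
  have := hinj (z * D.y - 1) (by rw [mul_sub, ← mul_assoc, hz]; simp)
  rwa [sub_eq_zero] at this

end SD
end D
end HopfAux

open Finset TensorProduct
set_option linter.unusedSectionVars false
set_option linter.unusedSimpArgs false
set_option linter.unusedVariables false
namespace HopfAux
open Coalgebra HopfAlgebra WithConv

section D
variable {k H ι : Type*} [Field k] [Ring H] [HopfAlgebra k H] [Fintype ι] [DecidableEq ι]

local notation "S" => HopfAlgebra.antipode (A := H) k
local notation "Δ" => Coalgebra.comul (R := k) (A := H)
local notation "ε" => Coalgebra.counit (R := k) (A := H)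

namespace SD
variable [CharZero k] [FiniteDimensional k H] (D : SD k H ι)

/-- inverse of y -/
noncomputable def u : H := ((D.y_isUnit.unit⁻¹ : Hˣ) : H)
lemma y_u : D.y * D.u = 1 := D.y_isUnit.mul_val_inv
lemma u_y : D.u * D.y = 1 := D.y_isUnit.val_inv_mul
lemma y_u_mul (a : H) : D.y * (D.u * a) = a := by rw [← mul_assoc, y_u, one_mul]
lemma u_y_mul (a : H) : D.u * (D.y * a) = a := by rw [← mul_assoc, u_y, one_mul]

lemma S2 (a : H) : S (S a) = D.y * a * D.u := by
  rw [← S2_y, mul_assoc, y_u, mul_one]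

lemma S_inj (D : SD k H ι) : Function.Injective (S) := by
  intro a b h
  have h1 := congrArg (fun x => D.u * S x * D.y) h
  simpa [D.S2, mul_assoc, D.u_y, D.u_y_mul] using h1

lemma S_surj (D : SD k H ι) : Function.Surjective (S) := LinearMap.injective_iff_surjective.1 D.S_inj

lemma S2_y' : S (S D.y) = D.y := by rw [D.S2, mul_assoc, y_u, mul_one]
lemma S2_u : S (S D.u) = D.u := by rw [D.S2, y_u, one_mul]

lemma c_S (i : ι) (a : H) : D.c i (S a) = D.c (D.st i) a := by rw [c, c, D.hst]; rfl

lemma c_S2 (i : ι) (a : H) : D.c i (S (S a)) = D.c i a := by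
  rw [D.S2, c, ch_comm, u_y_mul]

lemma c_inj {i j : ι} (h : D.c i = D.c j) : i = j := by
  by_contra hij
  have := congrArg (fun f => f (e D.W i)) h
  simp [c, ch_e, Ne.symm hij, (D.hd i).ne'] at this

lemma st_st (i : ι) : D.st (D.st i) = i := by
  apply D.c_inj
  ext a
  rw [← c_S, ← c_S, c_S2]

lemma st_inj {i j : ι} : D.st i = D.st j ↔ i = j :=
  ⟨fun h => by rw [← D.st_st i, h, D.st_st], fun h => by rw [h]⟩

/-- duality as a permutation -/
def stE : ι ≃ ι := ⟨D.st, D.st, D.st_st, D.st_st⟩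

lemma st_i0 : D.st D.i0 = D.i0 := by
  apply D.c_inj
  ext a
  rw [← c_S, c, D.h0]
  simp

lemma d_st (i : ι) : D.d (D.st i) = D.d i := by
  have : D.c (D.st i) 1 = D.c i 1 := by rw [← c_S]; simp
  simp only [c, ch_one] at this
  exact_mod_cast this

lemma t_S (a : H) : D.t (S a) = D.t a := by
  rw [t, th_apply, th_apply]
  exact Fintype.sum_equiv D.stE _ _ (fun i => D.c_S i a)

lemma S_e (i : ι) : S (e D.W (D.st i)) = e D.W i := by
  obtain ⟨z, hz⟩ := D.S_surj (e D.W i)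
  rw [← hz]
  congr 1
  apply th_ext D.W
  intro x
  rw [th_e_mul, ← D.c_S, c, ← th_e_mul, ← hz, ← antipode_mul_antidistrib, D.t_S, th_comm]

lemma S_L : S D.L = D.L := by
  have := D.S_e D.i0
  rwa [st_i0] at this

lemma conv_L (g : Module.Dual k H) (b : H) : 
    conv k H (D.t ∘ₗ LinearMap.mulLeft k b) (g ∘ₗ S) D.L = g (D.y * b) := by
  rw [conv_apply, ← D.S_J]; rfl

lemma c_eq (i : ι) : D.c i = D.t ∘ₗ LinearMap.mulLeft k (e D.W i) := by
  ext x; simp [th_e_mul]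

lemma c_c_L (i j : ι) : conv k H (D.c i) (D.c (D.st j)) D.L = if i = j then 1 else 0 := by
  rw [D.c_eq i]
  have : D.c (D.st j) = D.c j ∘ₗ S := D.hst j
  rw [this, conv_L, ← e_comm, c, ch_e_mul]
  by_cases h : i = j
  · subst h; simp [D.c_y]
  · simp [h, Ne.symm h]

lemma N_i0 (i j : ι) : D.N i (D.st j) D.i0 = if i = j then 1 else 0 := by
  have h := D.c_c_L i j
  rw [c, c, D.hN] at h
  simp only [LinearMap.sum_apply, LinearMap.smul_apply, D.c_L, smul_eq_mul] at h
  simp at h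
  split_ifs with hij
  · simp [hij] at h; rw [hij]; exact_mod_cast h
  · simp [hij] at h; exact_mod_cast h

/-- kappa as element -/
noncomputable def K : H := D.u * S D.u

lemma S_u_S_y : S D.u * S D.y = 1 := by
  rw [← antipode_mul_antidistrib, y_u]; simp
lemma S_y_S_u : S D.y * S D.u = 1 := by
  rw [← antipode_mul_antidistrib, u_y]; simp

lemma sy_comm (a : H) : S D.y * D.y * a = a * (S D.y * D.y) := by
  obtain ⟨b, rfl⟩ := D.S_surj a
  have h : D.y * S b * D.u = S D.u * S b * S D.y := by
    rw [← D.S2, D.S2 b, antipode_mul_antidistrib, antipode_mul_antidistrib]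
    simp [mul_assoc]
  have h2 := congrArg (fun x => S D.y * x * D.y) h
  simp only [mul_assoc, u_y, mul_one] at h2
  rw [← mul_assoc (S D.y) (S D.u), S_y_S_u, one_mul] at h2
  simpa [mul_assoc] using h2

lemma y_sy : D.y * S D.y = S D.y * D.y := by
  have h := D.sy_comm D.y
  have h2 := congrArg (fun x => x * D.u) h
  simp only [mul_assoc, y_u, mul_one] at h2
  exact h2.symm

lemma K_sy : D.K * (S D.y * D.y) = 1 := by
  rw [K, mul_assoc, ← mul_assoc (S D.u), S_u_S_y, one_mul, u_y]
lemma sy_K : (S D.y * D.y) * D.K = 1 := by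
  rw [K, mul_assoc, y_u_mul, S_y_S_u]

lemma K_comm (a : H) : D.K * a = a * D.K := by
  have h := congrArg (fun x => D.K * x * D.K) (D.sy_comm a)
  simp only [mul_assoc] at h
  have h1 : D.y * D.K = S D.u := by rw [K, y_u_mul]
  rw [h1, S_y_S_u, mul_one] at h
  have h2 := D.K_sy
  rw [← mul_assoc] at h2
  rw [← mul_assoc (S D.y), ← mul_assoc D.K] at h
  rw [K_sy, one_mul] at h
  exact h.symm

lemma K_eq : D.K = S D.u * D.u := by
  have h : D.K * (D.y * S D.y) = 1 := by rw [y_sy, K_sy]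
  have h2 := congrArg (fun x => x * (S D.u * D.u)) h
  simp only [one_mul] at h2
  rw [← h2, mul_assoc, mul_assoc, ← mul_assoc (S D.y), S_y_S_u, one_mul, y_u, mul_one]

lemma K_y : D.K * D.y = S D.u := by rw [K_eq, mul_assoc, u_y, mul_one]

lemma S_K : S D.K = D.K := by rw [K, antipode_mul_antidistrib, S2_u]

/-- scalars of kappa -/
noncomputable def kap : ι → k := (central_form D.W D.K_comm).choose
lemma K_form : D.K = ∑ i, D.kap i • e D.W i := (central_form D.W D.K_comm).choose_spec

lemma K_e (i : ι) : D.K * e D.W i = D.kap i • e D.W i := by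
  rw [K_form, e_mul_form]

lemma c_K (i : ι) (x : H) : D.c i (D.K * x) = D.kap i * D.c i x := by
  rw [K_form, c, ch_mul_form]

lemma kap_st (i : ι) : D.kap (D.st i) = D.kap i := by
  have h := D.c_K i 1
  rw [← S_K, mul_one, D.c_S] at h
  have h2 := D.c_K (D.st i) 1
  rw [mul_one, h] at h2
  simp only [c, ch_one, d_st] at h2
  have : (D.d i : k) ≠ 0 := by exact_mod_cast (D.hd i).ne'
  exact (mul_right_cancel₀ this h2).symm

lemma kap_ne (i : ι) : D.kap i ≠ 0 := by
  intro h
  have h1 := D.c_K i (S D.y * D.y)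
  rw [K_sy, h, zero_mul, c, ch_one] at h1
  have : (D.d i : k) ≠ 0 := by exact_mod_cast (D.hd i).ne'
  exact this h1

lemma counit_y : ε D.y = 1 := by rw [← D.h0]; exact D.c_y _
lemma counit_u : ε D.u = 1 := by
  have := congrArg (fun x => ε x) D.y_u
  simpa [Bialgebra.counit_mul, counit_y] using this

lemma kap_i0 : D.kap D.i0 = 1 := by
  have h := D.c_K D.i0 1
  rw [mul_one, c, D.h0, K, Bialgebra.counit_mul, counit_antipode, counit_u] at h
  simpa using h.symm

/-- mu -/
noncomputable def mu : Module.Dual k H := D.t ∘ₗ LinearMap.mulLeft k D.u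

lemma J_mu : D.J D.mu = 1 := by
  apply D.S_inj
  rw [mu, S_J, y_u]; simp

lemma J_inj {f g : Module.Dual k H} (h : D.J f = D.J g) : f = g := by
  obtain ⟨a, ha⟩ := th_surj D.W f
  obtain ⟨b, hb⟩ := th_surj D.W g
  have ha' : f = D.t ∘ₗ LinearMap.mulLeft k a := by ext x; simp [ha]
  have hb' : g = D.t ∘ₗ LinearMap.mulLeft k b := by ext x; simp [hb]
  have h1 := congrArg (fun x => S x) h
  simp only [ha', hb', S_J] at h1
  have h2 := congrArg (fun x => D.u * x) h1
  simp only [u_y_mul] at h2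
  rw [ha', hb', h2]

lemma J_conv (f g : Module.Dual k H) : D.J (conv k H f g) = P g (D.J f) := by
  rw [J, P_conv]; rfl

lemma P_one (f : Module.Dual k H) : P f (1 : H) = f 1 • (1 : H) := by
  apply dual_ext (k := k)
  intro g
  rw [← conv_apply, conv_one_apply]; simp

lemma J_smul (a : k) (f : Module.Dual k H) : D.J (a • f) = a • D.J f := by
  rw [J, P_smul]; rfl

lemma mu_conv (f : Module.Dual k H) : conv k H D.mu f = f 1 • D.mu := by
  apply D.J_inj
  rw [J_conv, J_mu, J_smul, J_mu, P_one]

lemma mu_L : D.mu D.L = 1 := by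
  rw [← counit_P]
  have := D.J_mu
  rw [J] at this
  rw [this]; simp

/-- distinguished grouplike -/
noncomputable def g : H := S D.u * D.y

lemma g_spec (f : Module.Dual k H) : conv k H f D.mu D.L = f D.g := by
  obtain ⟨b, hb⟩ := th_surj D.W f
  have hb' : f = D.t ∘ₗ LinearMap.mulLeft k b := by ext x; simp [hb]
  rw [conv_apply, hb]
  show D.t (D.u * D.J f) = _
  rw [← D.t_S, antipode_mul_antidistrib, hb', S_J, g, t, mul_assoc, th_comm, ← mul_assoc]

lemma conv_mu (f : Module.Dual k H) : conv k H f D.mu = f D.g • D.mu := by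
  apply D.J_inj
  set ν := conv k H f D.mu with hν
  have h1 : ∀ f' : Module.Dual k H, P f' (D.J ν) = f' 1 • D.J ν := by
    intro f'
    rw [← J_conv, hν, conv_assoc, mu_conv, conv_smul_right, J_smul]
  have h2 : D.J ν = ε (D.J ν) • (1 : H) := by
    apply dual_ext (k := k)
    intro f'
    rw [← counit_P, h1]; simp [mul_comm]
  rw [h2, J_smul, J_mu, ← g_spec, ← hν]
  congr 1
  exact counit_P _ _

lemma conv_g (f f' : Module.Dual k H) : conv k H f f' D.g = f D.g * f' D.g := by
  have h := D.conv_mu (conv k H f f')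
  rw [conv_assoc, conv_mu, conv_smul_right, conv_mu, smul_smul] at h
  have h1 := congrArg (fun f => f D.L) h
  simp [mu_L] at h1
  rw [← h1, mul_comm]

/-- tensor extensionality -/
lemma tensor_ext {x y : H ⊗[k] H} (h : ∀ f g : Module.Dual k H,
    LinearMap.mul' k k (TensorProduct.map f g x) = LinearMap.mul' k k (TensorProduct.map f g y)) :
    x = y := by
  rw [← sub_eq_zero]
  rw [← Module.forall_dual_apply_eq_zero_iff k]
  intro F
  obtain ⟨z, rfl⟩ := (TensorProduct.dualDistribEquiv k H H).surjective F
  change TensorProduct.dualDistrib k H H z (x - y) = 0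
  induction z with
  | zero => simp
  | add a b ha hb => rw [map_add, LinearMap.add_apply, ha, hb, add_zero]
  | tmul f g =>
    have h2 : TensorProduct.dualDistrib k H H (f ⊗ₜ g) = LinearMap.mul' k k ∘ₗ TensorProduct.map f g := by
      ext a b; simp
    rw [h2, map_sub, LinearMap.comp_apply, LinearMap.comp_apply, h, sub_self]

lemma comul_g : Δ D.g = D.g ⊗ₜ D.g := by
  apply tensor_ext
  intro f g
  have := D.conv_g f g
  simpa [conv] using this

end SD
end D
end HopfAux

open Finset TensorProduct
set_option linter.unusedSectionVars false
set_option linter.unusedSimpArgs false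
set_option linter.unusedVariables false
namespace HopfAux
open Coalgebra HopfAlgebra WithConv

section D
variable {k H ι : Type*} [Field k] [Ring H] [HopfAlgebra k H] [Fintype ι] [DecidableEq ι]

local notation "S" => HopfAlgebra.antipode (A := H) k
local notation "Δ" => Coalgebra.comul (R := k) (A := H)
local notation "ε" => Coalgebra.counit (R := k) (A := H)

namespace SD
variable [CharZero k] [FiniteDimensional k H] (D : SD k H ι)

/-- twisted characters -/
noncomputable def F (i : ι) : Module.Dual k H := D.c i ∘ₗ LinearMap.mulLeft k D.u

lemma F_apply (i : ι) (x : H) : D.F i x = D.c i (D.u * x) := rfl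

lemma F_tw (i : ι) (a b : H) : D.F i (a * b) = D.F i (S (S b) * a) := by
  rw [F_apply, F_apply, D.S2]
  simp only [mul_assoc, u_y_mul]
  rw [c, ← mul_assoc, ch_comm]

lemma conv_mul (f f' : Module.Dual k H) (a b : H) : conv k H f f' (a * b) =
    ∑ i ∈ (ℛ k a).index, ∑ j ∈ (ℛ k b).index,
      f ((ℛ k a).left i * (ℛ k b).left j) * f' ((ℛ k a).right i * (ℛ k b).right j) := by
  have h : Δ (a * b) = ∑ i ∈ (ℛ k a).index, ∑ j ∈ (ℛ k b).index,
      ((ℛ k a).left i * (ℛ k b).left j) ⊗ₜ[k] ((ℛ k a).right i * (ℛ k b).right j) := by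
    rw [Bialgebra.comul_mul, ← (ℛ k a).eq, ← (ℛ k b).eq, Finset.sum_mul_sum]
    simp
  simp [conv, h]

lemma conv_tw (f f' : Module.Dual k H) (hf : ∀ a b, f (a * b) = f (S (S b) * a))
    (hf' : ∀ a b, f' (a * b) = f' (S (S b) * a)) (a b : H) :
    conv k H f f' (a * b) = conv k H f f' (S (S b) * a) := by
  rw [conv_mul]
  have h : Δ (S (S b) * a) = ∑ i ∈ (ℛ k a).index, ∑ j ∈ (ℛ k b).index,
      (S (S ((ℛ k b).left j)) * (ℛ k a).left i) ⊗ₜ[k] (S (S ((ℛ k b).right j)) * (ℛ k a).right i) := by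
    rw [Bialgebra.comul_mul, comul_antipode_sq, ← (ℛ k a).eq, ← (ℛ k b).eq, map_sum,
      Finset.sum_mul_sum, Finset.sum_comm]
    simp
  simp only [conv, h, LinearMap.comp_apply, map_sum, TensorProduct.map_tmul, LinearMap.mul'_apply]
  refine Finset.sum_congr rfl fun i _ => Finset.sum_congr rfl fun j _ => ?_
  rw [hf, hf']

lemma tw_form (f : Module.Dual k H) (hf : ∀ a b, f (a * b) = f (S (S b) * a)) :
    ∃ c : ι → k, f = ∑ i, c i • D.F i := by
  obtain ⟨c, hc⟩ := trace_form D.W (f := f ∘ₗ LinearMap.mulLeft k D.y) (by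
    intro a b
    simp only [LinearMap.comp_apply, LinearMap.mulLeft_apply]
    rw [← mul_assoc, hf, ← mul_assoc, S2_y, mul_assoc])
  refine ⟨c, ?_⟩
  ext x
  have := congrArg (fun f => f (D.u * x)) hc
  simpa [y_u_mul, F_apply] using this

lemma exists_tt (i j : ι) : ∃ c : ι → k, conv k H (D.F i) (D.F j) = ∑ l, c l • D.F l :=
  D.tw_form _ (conv_tw _ _ (D.F_tw i) (D.F_tw j))

/-- structure constants of the twisted ring -/
noncomputable def tt (i j : ι) : ι → k := (D.exists_tt i j).choose
lemma tt_spec (i j : ι) : conv k H (D.F i) (D.F j) = ∑ l, D.tt i j l • D.F l :=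
  (D.exists_tt i j).choose_spec

lemma F_L (i : ι) : D.F i D.L = if i = D.i0 then 1 else 0 := by
  rw [F_apply, L_left, counit_u, one_smul, c_L]

lemma F_i0 : D.F D.i0 = ε := by
  ext x
  rw [F_apply, c, D.h0, Bialgebra.counit_mul, counit_u, one_mul]

lemma c_u (i : ι) : D.c i D.u = D.kap i := by
  have h : D.K * S D.y = D.u := by rw [K, mul_assoc, S_u_S_y, mul_one]
  rw [← h, c_K, c_S, c_y, mul_one]

lemma J_F (i : ι) : D.J (D.F i) = e D.W (D.st i) := by
  have h : D.F i = D.t ∘ₗ LinearMap.mulLeft k (e D.W i * D.u) := by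
    ext x; simp [F_apply, th_e_mul, mul_assoc]
  apply D.S_inj
  rw [h, S_J, S_e, e_comm, ← mul_assoc, y_u, one_mul]

lemma F_F_L (i j : ι) : conv k H (D.F i) (D.F j) D.L = if j = D.st i then D.kap i else 0 := by
  rw [conv_apply]
  show D.F j (D.J (D.F i)) = _
  rw [J_F, F_apply, c, ← e_comm, ch_e_mul]
  split_ifs with h
  · rw [← kap_st, ← h]; exact D.c_u j
  · rfl

/-- inverse of g -/
noncomputable def gi : H := S D.y * D.u

lemma gi_g : D.gi * D.g = 1 := by
  have h : D.u * S D.u = S D.u * D.u := D.K_eq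
  rw [gi, g, mul_assoc, ← mul_assoc D.u, h, mul_assoc, u_y, mul_one, S_y_S_u]
lemma g_gi : D.g * D.gi = 1 := by
  rw [gi, g, mul_assoc, ← mul_assoc D.y, y_sy, mul_assoc, y_u, mul_one, S_u_S_y]

lemma comul_gi : Δ D.gi = D.gi ⊗ₜ D.gi := by
  have h1 : Δ D.gi * (D.g ⊗ₜ D.g) = 1 := by
    rw [← comul_g, ← Bialgebra.comul_mul, gi_g, Bialgebra.comul_one]
  have h2 := congrArg (fun x => x * (D.gi ⊗ₜ[k] D.gi)) h1
  simp only [mul_assoc, Algebra.TensorProduct.tmul_mul_tmul, g_gi, one_mul] at h2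
  rwa [← Algebra.TensorProduct.one_def, mul_one] at h2

lemma S_gi : S D.gi = D.g := by
  rw [gi, antipode_mul_antidistrib, S2_y', g]

/-- star operation -/
noncomputable def star' (f : Module.Dual k H) : Module.Dual k H := f ∘ₗ S ∘ₗ LinearMap.mulLeft k D.gi

lemma star_apply (f : Module.Dual k H) (h : H) : D.star' f h = f (S (D.gi * h)) := rfl

lemma star_conv (f f' : Module.Dual k H) :
    D.star' (conv k H f f') = conv k H (D.star' f') (D.star' f) := by
  ext h
  rw [star_apply, conv_antipode]
  have : Δ (D.gi * h) = ∑ i ∈ (ℛ k h).index, (D.gi * (ℛ k h).left i) ⊗ₜ[k] (D.gi * (ℛ k h).right i) := by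
    rw [Bialgebra.comul_mul, comul_gi, ← (ℛ k h).eq, Finset.mul_sum]
    simp
  rw [conv_repr _ _ (ℛ k h), conv]
  simp [this, star_apply]

lemma star_F (i : ι) : D.star' (D.F i) = D.F (D.st i) := by
  ext h
  rw [star_apply, F_apply, F_apply, ← c_S, antipode_mul_antidistrib, antipode_mul_antidistrib,
    S_gi, ← mul_assoc, c, ch_comm]
  have h1 : D.g * D.u = S D.u := by rw [g, mul_assoc, y_u, mul_one]
  rw [← mul_assoc, h1, ch_comm]

lemma star_sum (c : ι → k) : D.star' (∑ l, c l • D.F l) = ∑ l, c l • D.F (D.st l) := by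
  ext h
  simp only [star_apply, LinearMap.sum_apply, LinearMap.smul_apply, ← star_F]

lemma F_symm (i j : ι) : conv k H (D.F i) (D.F j) D.L = conv k H (D.F j) (D.F i) D.L := by
  rw [F_F_L, F_F_L]
  by_cases h : j = D.st i
  · subst h; simp [st_st, kap_st]
  · have : i ≠ D.st j := by rintro rfl; simp [st_st] at h
    simp [h, this]

lemma tt_F (i j l : ι) : conv k H (conv k H (D.F i) (D.F j)) (D.F (D.st l)) D.L =
    D.tt i j l * D.kap l := by
  rw [tt_spec, conv_sum_left, LinearMap.sum_apply]
  simp only [conv_smul_left, LinearMap.smul_apply, F_F_L, st_inj]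
  simp

lemma tt_symm (i j l : ι) : D.tt (D.st i) l j * D.kap j = D.tt i j l * D.kap l := by
  rw [← tt_F, ← tt_F, conv_assoc]
  have h1 : conv k H (D.F (D.st i)) (conv k H (D.F l) (D.F (D.st j))) D.L =
      conv k H (conv k H (D.F l) (D.F (D.st j))) (D.F (D.st i)) D.L := by
    rw [tt_spec, conv_sum_left, conv_sum_right, LinearMap.sum_apply, LinearMap.sum_apply]
    simp only [conv_smul_left, conv_smul_right, LinearMap.smul_apply, D.F_symm (D.st i)]
  have h2 : D.star' (conv k H (conv k H (D.F i) (D.F j)) (D.F (D.st l))) =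
      conv k H (conv k H (D.F l) (D.F (D.st j))) (D.F (D.st i)) := by
    rw [star_conv, star_conv, star_F, star_F, star_F, st_st, conv_assoc]
  have h3 : ε D.gi = 1 := by
    rw [gi, Bialgebra.counit_mul, counit_antipode, counit_u, counit_y, one_mul]
  rw [h1, ← h2, star_apply, L_left, h3, one_smul, S_L]

lemma F_one (i : ι) : D.F i 1 = D.kap i := by rw [F_apply, mul_one, c_u]

lemma mu_one : D.mu 1 = ∑ i, D.kap i := by
  simp only [mu, LinearMap.comp_apply, LinearMap.mulLeft_apply, mul_one, t, th_apply]
  exact Finset.sum_congr rfl fun i _ => D.c_u i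

lemma tt_one (i j : ι) : D.kap i * D.kap j = ∑ l, D.tt i j l * D.kap l := by
  have := congrArg (fun f => f (1 : H)) (D.tt_spec i j)
  simpa [conv_one_apply, F_one] using this

lemma F_ext {a b : ι → k} (h : ∑ i, a i • D.F i = ∑ i, b i • D.F i) : a = b := by
  apply ch_li D.W D.hd
  ext x
  have := congrArg (fun f => f (D.y * x)) h
  simpa [F_apply, u_y_mul] using this

lemma tt_i0 (j l : ι) : D.tt D.i0 j l = if l = j then 1 else 0 := by
  have h := D.tt_spec D.i0 j
  rw [F_i0, conv_counit_left] at h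
  have h2 : D.F j = ∑ l, (if l = j then (1 : k) else 0) • D.F l := by simp
  rw [h2] at h
  exact congrFun (D.F_ext h).symm l

lemma tt_assoc (i j m l : ι) : ∑ p, D.tt i j p * D.tt p m l = ∑ p, D.tt j m p * D.tt i p l := by
  have h := conv_assoc (D.F i) (D.F j) (D.F m)
  rw [D.tt_spec i j, D.tt_spec j m, conv_sum_left, conv_sum_right] at h
  simp only [conv_smul_left, conv_smul_right, tt_spec, Finset.smul_sum, smul_smul] at h
  rw [Finset.sum_comm, Finset.sum_comm (s := Finset.univ) (t := Finset.univ)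
    (f := fun x y => (D.tt j m x * D.tt i x y) • D.F y)] at h
  simp only [← Finset.sum_smul] at h
  exact congrFun (D.F_ext h) l

end SD
end D
end HopfAux

open Finset TensorProduct
set_option linter.unusedSectionVars false
set_option linter.unusedSimpArgs false
set_option linter.unusedVariables false
namespace HopfAux
open Coalgebra HopfAlgebra WithConv

section T
variable {K : Type*} [Field K] [CharZero K] {n : Type*} [Fintype n] [DecidableEq n]

lemma trace_idem (M : Matrix n n K) (h : M * M = M) :
    ∃ r : ℕ, r ≤ Fintype.card n ∧ M.trace = r ∧ (r = 0 → M = 0) := by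
  let f := Matrix.toLin' M
  have hf : IsIdempotentElem f := by
    show f * f = f
    simp only [f, ← Matrix.toLin'_mul_apply]
    rw [Module.End.mul_eq_comp, ← Matrix.toLin'_mul, h]
  have h1 := (LinearMap.IsIdempotentElem.isProj_range f hf).trace
  refine ⟨Module.finrank K (LinearMap.range f), ?_, ?_, ?_⟩
  · refine (Submodule.finrank_le _).trans ?_
    simp
  · rw [← h1, Matrix.trace_toLin'_eq]
  · intro h0
    have : LinearMap.range f = ⊥ := Submodule.finrank_eq_zero.1 h0
    rw [LinearMap.range_eq_bot] at this
    simpa [f] using this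

lemma trace_cube_mat (M : Matrix n n K) (h : M * M * M = M) :
    ∃ r : ℤ, |r| ≤ Fintype.card n ∧ M.trace = r := by
  have h4 : M * M * (M * M) = M * M := by rw [← mul_assoc, h]
  have hp : ((2 : K)⁻¹ • (M * M + M)) * ((2 : K)⁻¹ • (M * M + M)) = (2 : K)⁻¹ • (M * M + M) := by
    rw [smul_mul_smul_comm]
    have : (M * M + M) * (M * M + M) = (2 : K) • (M * M + M) := by
      rw [add_mul, mul_add, mul_add, h4, h, ← mul_assoc M M M, h, two_smul]; abel
    rw [this, smul_smul]; norm_num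
  have hm : ((2 : K)⁻¹ • (M * M - M)) * ((2 : K)⁻¹ • (M * M - M)) = (2 : K)⁻¹ • (M * M - M) := by
    rw [smul_mul_smul_comm]
    have : (M * M - M) * (M * M - M) = (2 : K) • (M * M - M) := by
      rw [sub_mul, mul_sub, mul_sub, h4, h, ← mul_assoc M M M, h, two_smul]; abel
    rw [this, smul_smul]; norm_num
  obtain ⟨r, hr, hr', -⟩ := trace_idem _ hp
  obtain ⟨s, hs, hs', -⟩ := trace_idem _ hm
  refine ⟨r - s, ?_, ?_⟩
  · rw [abs_le]; omega
  · push_cast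
    rw [← hr', ← hs', ← Matrix.trace_sub, ← smul_sub]
    congr 1
    rw [add_sub_sub_cancel, ← two_smul K, smul_smul]; norm_num

lemma trace_cube {k : Type*} [Field k] [Algebra k K] {V : Type*} [AddCommGroup V] [Module k V]
    [FiniteDimensional k V] (B : V →ₗ[k] V) (κ : k) (c : K) (hc : c ≠ 0)
    (hκ : algebraMap k K κ = c * c) (h : B ∘ₗ B ∘ₗ B = κ • B) :
    ∃ r : ℤ, |r| ≤ Module.finrank k V ∧ algebraMap k K (LinearMap.trace k V B) = c * r := by
  classical
  let b := Module.finBasis k V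
  let M := LinearMap.toMatrix b b B
  have hM : M * (M * M) = κ • M := by
    simp only [M]
    rw [← LinearMap.toMatrix_comp b b b, ← LinearMap.toMatrix_comp b b b, h, map_smul]
  let M' := c⁻¹ • (algebraMap k K).mapMatrix M
  have hM' : M' * M' * M' = M' := by
    have := congrArg (algebraMap k K).mapMatrix hM
    have h2 : (algebraMap k K).mapMatrix (κ • M) = (c * c) • (algebraMap k K).mapMatrix M := by
      ext i j; simp [hκ]
    rw [map_mul, map_mul, h2] at this
    simp only [M']
    rw [mul_assoc, smul_mul_smul_comm, smul_mul_smul_comm, this, smul_smul]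
    congr 1
    field_simp
  obtain ⟨r, hr, hr'⟩ := trace_cube_mat M' hM'
  refine ⟨r, by simpa using hr, ?_⟩
  rw [← hr', LinearMap.trace_eq_matrix_trace k b]
  simp only [M', Matrix.trace_smul, smul_eq_mul]
  rw [← mul_assoc, mul_inv_cancel₀ hc, one_mul]
  simp [Matrix.trace, M]

end T

section D
variable {k H ι : Type*} [Field k] [Ring H] [HopfAlgebra k H] [Fintype ι] [DecidableEq ι]

local notation "S" => HopfAlgebra.antipode (A := H) k
local notation "Δ" => Coalgebra.comul (R := k) (A := H)
local notation "ε" => Coalgebra.counit (R := k) (A := H)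

namespace SD
variable [CharZero k] [FiniteDimensional k H] (D : SD k H ι)

/-- the twisted element -/
noncomputable def X (l : ι) : H ⊗[k] H := (D.u ⊗ₜ D.u) * Δ (e D.W l * D.y)

lemma comul_S2 (h : H) : (D.y ⊗ₜ[k] D.y) * Δ h = Δ (D.y * h * D.u) * (D.y ⊗ₜ[k] D.y) := by
  rw [← D.S2, comul_antipode_sq, ← (ℛ k h).eq, Finset.mul_sum, map_sum, Finset.sum_mul]
  refine Finset.sum_congr rfl fun i _ => ?_
  simp [D.S2, mul_assoc, u_y]

lemma uu_yy : (D.u ⊗ₜ[k] D.u) * (D.y ⊗ₜ[k] D.y) = 1 := by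
  simp [u_y, Algebra.TensorProduct.one_def]
lemma yy_uu : (D.y ⊗ₜ[k] D.y) * (D.u ⊗ₜ[k] D.u) = 1 := by
  simp [y_u, Algebra.TensorProduct.one_def]

lemma comul_u_comm (h : H) (hh : D.y * h = h * D.y) :
    (D.u ⊗ₜ[k] D.u) * Δ h = Δ h * (D.u ⊗ₜ[k] D.u) := by
  have h1 := D.comul_S2 h
  rw [hh, mul_assoc, y_u, mul_one] at h1
  have h2 := congrArg (fun x => (D.u ⊗ₜ[k] D.u) * x * (D.u ⊗ₜ[k] D.u)) h1
  simp only [mul_assoc] at h2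
  rw [yy_uu, mul_one, ← mul_assoc, ← mul_assoc, uu_yy, one_mul] at h2
  exact h2.symm

lemma KK_comm (x : H ⊗[k] H) : (D.K ⊗ₜ[k] D.K) * x = x * (D.K ⊗ₜ[k] D.K) := by
  induction x with
  | zero => simp
  | add a b ha hb => rw [mul_add, add_mul, ha, hb]
  | tmul a b => simp [K_comm]

lemma ee_comm (i j : ι) (x : H ⊗[k] H) :
    (e D.W i ⊗ₜ[k] e D.W j) * x = x * (e D.W i ⊗ₜ[k] e D.W j) := by
  induction x with
  | zero => simp
  | add a b ha hb => rw [mul_add, add_mul, ha, hb]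
  | tmul a b => simp [e_comm]

lemma X_sq (l : ι) : D.X l * D.X l = (D.kap l)⁻¹ • ((D.K ⊗ₜ[k] D.K) * Δ (e D.W l)) := by
  have hy : D.y * (e D.W l * D.y) = (e D.W l * D.y) * D.y := by
    rw [← mul_assoc, ← e_comm]
  have hg : D.g = D.K * D.y * D.y := by rw [K_y, g]
  have hee : e D.W l * e D.W l = e D.W l := by simp [e_mul_e]
  have h1 : e D.W l * D.y * (e D.W l * D.y) = (D.kap l)⁻¹ • (e D.W l * D.g) := by
    have h2 : e D.W l * D.g = D.kap l • (e D.W l * D.y * D.y) := by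
      rw [hg, ← mul_assoc, ← mul_assoc, ← K_comm, K_e]
      simp
    rw [h2, smul_smul, inv_mul_cancel₀ (D.kap_ne l), one_smul, mul_assoc _ D.y, ← mul_assoc D.y,
      ← e_comm D.W, mul_assoc, ← mul_assoc (e D.W l), hee]
  have hgg : D.g ⊗ₜ[k] D.g = (D.K ⊗ₜ[k] D.K) * ((D.y ⊗ₜ[k] D.y) * (D.y ⊗ₜ[k] D.y)) := by
    simp [hg, mul_assoc]
  have hue := D.comul_u_comm (e D.W l) (e_comm D.W l D.y).symm
  calc D.X l * D.X l = (D.u ⊗ₜ D.u) * (Δ (e D.W l * D.y) * (D.u ⊗ₜ D.u)) * Δ (e D.W l * D.y) := by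
        simp only [X, mul_assoc]
    _ = (D.u ⊗ₜ D.u) * (D.u ⊗ₜ D.u) * (Δ (e D.W l * D.y) * Δ (e D.W l * D.y)) := by
        rw [← D.comul_u_comm _ hy]; simp only [mul_assoc]
    _ = (D.u ⊗ₜ D.u) * (D.u ⊗ₜ D.u) * ((D.kap l)⁻¹ • (Δ (e D.W l) * (D.g ⊗ₜ[k] D.g))) := by
        rw [← Bialgebra.comul_mul, h1, map_smul, Bialgebra.comul_mul, comul_g]
    _ = _ := by
        rw [hgg, mul_smul_comm]
        congr 1
        rw [← mul_assoc (Δ _), ← KK_comm, mul_assoc (D.K ⊗ₜ[k] D.K), ← mul_assoc _ (D.K ⊗ₜ[k] D.K),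
          ← KK_comm, mul_assoc]
        congr 1
        rw [mul_assoc, ← mul_assoc (D.u ⊗ₜ[k] D.u) (Δ _), hue, mul_assoc (Δ _),
          ← mul_assoc (D.u ⊗ₜ[k] D.u) (D.y ⊗ₜ[k] D.y), uu_yy, one_mul, ← mul_assoc, hue, mul_assoc,
          uu_yy, mul_one]

lemma X_cube (l : ι) : D.X l * (D.X l * D.X l) = (D.kap l)⁻¹ • ((D.K ⊗ₜ[k] D.K) * D.X l) := by
  have hue := D.comul_u_comm (e D.W l) (e_comm D.W l D.y).symm
  rw [← mul_assoc, X_sq, smul_mul_assoc, mul_assoc]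
  congr 2
  rw [X, ← mul_assoc, ← hue, mul_assoc, ← Bialgebra.comul_mul, ← mul_assoc, e_mul_e]
  simp

lemma B_cube (i j l : ι) : LinearMap.mulLeft k ((e D.W i ⊗ₜ[k] e D.W j) * D.X l) ∘ₗ
    LinearMap.mulLeft k ((e D.W i ⊗ₜ[k] e D.W j) * D.X l) ∘ₗ
    LinearMap.mulLeft k ((e D.W i ⊗ₜ[k] e D.W j) * D.X l) =
    (D.kap i * D.kap j / D.kap l) • LinearMap.mulLeft k ((e D.W i ⊗ₜ[k] e D.W j) * D.X l) := by
  have hee : (e D.W i ⊗ₜ[k] e D.W j) * (e D.W i ⊗ₜ[k] e D.W j) = (e D.W i ⊗ₜ[k] e D.W j) := by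
    simp [e_mul_e]
  set E := (e D.W i ⊗ₜ[k] e D.W j) with hE
  set B := E * D.X l with hB
  have h1 : B * (B * B) = (D.kap i * D.kap j / D.kap l) • B := by
    have : B * (B * B) = E * (D.X l * (D.X l * D.X l)) := by
      have hc : Commute (D.X l) E := (D.ee_comm i j (D.X l)).symm
      rw [hB, hc.mul_mul_mul_comm, hee, hc.mul_mul_mul_comm, hee]
    rw [this, X_cube, mul_smul_comm, ← mul_assoc, hE]
    simp only [Algebra.TensorProduct.tmul_mul_tmul, ← K_comm, K_e, hB, TensorProduct.smul_tmul_smul, hE,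
      smul_mul_assoc, smul_smul]
    congr 1
    field_simp
  refine LinearMap.ext fun x => ?_
  simp only [LinearMap.comp_apply, LinearMap.mulLeft_apply, LinearMap.smul_apply]
  rw [← smul_mul_assoc, ← h1, mul_assoc B (B * B) x, mul_assoc B B x]

lemma tr_e (i : ι) (h : H) : LinearMap.trace k H (LinearMap.mulLeft k (e D.W i * h)) =
    D.d i * D.c i h := by
  have := trace_lr D.W (e D.W i * h) 1
  rw [LinearMap.mulRight_one, LinearMap.comp_id] at this
  rw [this]
  simp [ch_e_mul, ch_one, mul_comm]

lemma B_trace (i j l : ι) : LinearMap.trace k (H ⊗[k] H)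
    (LinearMap.mulLeft k ((e D.W i ⊗ₜ[k] e D.W j) * D.X l)) =
    D.d i * D.d j * D.d l * D.tt i j l := by
  have h1 : ∀ x : H ⊗[k] H, LinearMap.trace k (H ⊗[k] H)
      (LinearMap.mulLeft k ((e D.W i ⊗ₜ[k] e D.W j) * ((D.u ⊗ₜ[k] D.u) * x))) =
      D.d i * D.d j * LinearMap.mul' k k (TensorProduct.map (D.F i) (D.F j) x) := by
    intro x
    induction x with
    | zero => simp
    | add a b ha hb =>
      have : ∀ p q : H ⊗[k] H, LinearMap.mulLeft k (p + q) = LinearMap.mulLeft k p + LinearMap.mulLeft k q := by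
        intro p q; exact LinearMap.ext fun x => by simp [add_mul]
      rw [mul_add, mul_add, this, map_add, ha, hb, map_add, map_add, mul_add]
    | tmul a b =>
      simp only [Algebra.TensorProduct.tmul_mul_tmul]
      have : LinearMap.mulLeft k ((e D.W i * (D.u * a)) ⊗ₜ[k] (e D.W j * (D.u * b))) =
          TensorProduct.map (LinearMap.mulLeft k (e D.W i * (D.u * a)))
            (LinearMap.mulLeft k (e D.W j * (D.u * b))) := by
        ext p q; simp [mul_assoc]
      rw [this, LinearMap.trace_tensorProduct', tr_e, tr_e]
      simp [F_apply]
      ring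
  rw [X, h1]
  have h2 : LinearMap.mul' k k (TensorProduct.map (D.F i) (D.F j) (Δ (e D.W l * D.y))) =
      conv k H (D.F i) (D.F j) (e D.W l * D.y) := rfl
  rw [h2, tt_spec]
  have h3 : ∀ m, D.F m (e D.W l * D.y) = if m = l then (D.d l : k) else 0 := by
    intro m
    rw [F_apply, ← mul_assoc, ← e_comm, mul_assoc, u_y, mul_one, c, ch_e]
    split_ifs with h
    · rw [h]
    · rfl
  simp [h3]
  ring

lemma tt_rat {Kb : Type*} [Field Kb] [CharZero Kb] [Algebra k Kb] (r : ι → Kb)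
    (hr : ∀ i, algebraMap k Kb (D.kap i) = r i * r i) (i j l : ι) :
    ∃ q : ℚ, algebraMap k Kb (D.tt i j l) * r l / (r i * r j) = q := by
  have hr0 : ∀ i, r i ≠ 0 := by
    intro i h
    have := hr i
    rw [h, mul_zero, map_eq_zero] at this
    exact D.kap_ne i this
  obtain ⟨n, -, hn⟩ := trace_cube (K := Kb) _ _ (r i * r j / r l)
    (by have := hr0 i; have := hr0 j; have := hr0 l; positivity)
    (by rw [map_div₀, map_mul, hr, hr, hr]; field_simp) (D.B_cube i j l)
  rw [B_trace] at hn
  refine ⟨n / (D.d i * D.d j * D.d l), ?_⟩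
  have h1 := hr0 i; have h2 := hr0 j; have h3 := hr0 l
  have h4 : (D.d i : Kb) ≠ 0 := by exact_mod_cast (D.hd i).ne'
  have h5 : (D.d j : Kb) ≠ 0 := by exact_mod_cast (D.hd j).ne'
  have h6 : (D.d l : Kb) ≠ 0 := by exact_mod_cast (D.hd l).ne'
  push_cast
  simp only [map_mul, map_natCast] at hn
  field_simp at hn ⊢
  linear_combination hn

end SD
end D
end HopfAux

open Finset TensorProduct
set_option linter.unusedSectionVars false
set_option linter.unusedSimpArgs false
set_option linter.unusedVariables false
namespace HopfAux
open Coalgebra HopfAlgebra WithConv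

lemma pos_eig {ι n : Type*} [Fintype ι] [DecidableEq ι] [Fintype n] [DecidableEq n]
    (A : ι → Matrix n n ℚ) (i0 : ι)
    (h0 : A i0 = 1) (v : n → ℚ) (hv : v ≠ 0) (c : ℚ)
    (h : (∑ i, A i * (A i).transpose).mulVec v = c • v) : 1 ≤ c := by
  have h1 : v ⬝ᵥ ((∑ i, A i * (A i).transpose).mulVec v) =
      ∑ i, ((A i).transpose.mulVec v) ⬝ᵥ ((A i).transpose.mulVec v) := by
    rw [Matrix.sum_mulVec, dotProduct_sum]
    refine Finset.sum_congr rfl fun i _ => ?_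
    rw [← Matrix.mulVec_mulVec, Matrix.dotProduct_mulVec, ← Matrix.mulVec_transpose]
  have h2 : v ⬝ᵥ v ≤ ∑ i, ((A i).transpose.mulVec v) ⬝ᵥ ((A i).transpose.mulVec v) := by
    have := Finset.single_le_sum (f := fun i => ((A i).transpose.mulVec v) ⬝ᵥ ((A i).transpose.mulVec v))
      (s := Finset.univ) (fun i _ => Finset.sum_nonneg fun j _ => mul_self_nonneg _) (Finset.mem_univ i0)
    simpa [h0] using this
  have h3 : 0 < v ⬝ᵥ v := by
    refine lt_of_le_of_ne (Finset.sum_nonneg fun j _ => mul_self_nonneg _) ?_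
    intro h
    exact hv (dotProduct_self_eq_zero.1 h.symm)
  rw [← h1, h, dotProduct_smul, smul_eq_mul] at h2
  by_contra! hc
  nlinarith

section D
variable {k H ι : Type*} [Field k] [Ring H] [HopfAlgebra k H] [Fintype ι] [DecidableEq ι]

local notation "S" => HopfAlgebra.antipode (A := H) k
local notation "Δ" => Coalgebra.comul (R := k) (A := H)
local notation "ε" => Coalgebra.counit (R := k) (A := H)

namespace SD
variable [CharZero k] [FiniteDimensional k H] (D : SD k H ι)

lemma mu_one_ne_aux (Kb : Type*) [Field Kb] [CharZero Kb] [Algebra k Kb] [IsAlgClosed Kb] :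
    D.mu 1 ≠ 0 := by
  classical
  intro hmu
  rw [mu_one] at hmu
  have hq : ∀ x : k, ∃ z : Kb, algebraMap k Kb x = z * z ∧ (x = 1 → z = 1) := by
    intro x
    by_cases hx : x = 1
    · exact ⟨1, by simp [hx], fun _ => rfl⟩
    · obtain ⟨z, hz⟩ := IsAlgClosed.exists_pow_nat_eq (algebraMap k Kb x) (n := 2) (by norm_num)
      exact ⟨z, by rw [← hz, sq], fun h => absurd h hx⟩
  choose q hq1 hq2 using hq
  let r : ι → Kb := fun i => q (D.kap i)
  have hr : ∀ i, algebraMap k Kb (D.kap i) = r i * r i := fun i => hq1 _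
  have hrst : ∀ i, r (D.st i) = r i := fun i => by simp only [r, kap_st]
  have hri0 : r D.i0 = 1 := hq2 _ D.kap_i0
  have hr0 : ∀ i, r i ≠ 0 := by
    intro i h
    have := hr i
    rw [h, mul_zero, map_eq_zero] at this
    exact D.kap_ne i this
  choose T hT using D.tt_rat r hr
  have hTi0 : ∀ j l, T D.i0 j l = if l = j then 1 else 0 := by
    intro j l
    have h := hT D.i0 j l
    rw [tt_i0, hri0] at h
    split_ifs with hjl
    · subst hjl
      have h1 := hr0 l
      simp [h1] at h
      exact_mod_cast h.symm
    · simp [hjl] at h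
      exact_mod_cast h.symm
  have hTst : ∀ i j l, T (D.st i) l j = T i j l := by
    intro i j l
    have : ((T (D.st i) l j : ℚ) : Kb) = T i j l := by
      rw [← hT, ← hT, hrst]
      have h1 := hr0 i; have h2 := hr0 j; have h3 := hr0 l
      have h4 := congrArg (algebraMap k Kb) (D.tt_symm i j l)
      rw [map_mul, map_mul, hr, hr] at h4
      field_simp
      linear_combination h4
    exact_mod_cast this
  let A : ι → Matrix ι ι ℚ := fun i => Matrix.of fun l j => T i j l
  have hA0 : A D.i0 = 1 := by
    ext l j
    simp [A, hTi0, Matrix.one_apply]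
  have hAst : ∀ i, A (D.st i) = (A i).transpose := by
    intro i; ext l j
    simp only [A, Matrix.of_apply, Matrix.transpose_apply]
    rw [hTst]
  have hdet : (∑ i, A i * (A i).transpose).det ≠ 0 := by
    intro h
    obtain ⟨v, hv, hv0⟩ := Matrix.exists_mulVec_eq_zero_iff.2 h
    have := pos_eig A D.i0 hA0 v hv 0 (by rw [hv0, zero_smul])
    norm_num at this
  let cK : ℚ →+* Kb := Rat.castHom Kb
  have hrow : ∀ i, Matrix.vecMul r (cK.mapMatrix (A i)) = r i • r := by
    intro i; ext j
    simp only [Matrix.vecMul, dotProduct, RingHom.mapMatrix_apply, Matrix.map_apply, A,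
      Matrix.of_apply, Pi.smul_apply, smul_eq_mul, cK, Rat.coe_castHom]
    simp only [← hT]
    have h1 := hr0 i; have h2 := hr0 j
    have h4 := congrArg (algebraMap k Kb) (D.tt_one i j)
    rw [map_mul, map_sum, hr, hr] at h4
    simp only [map_mul, hr] at h4
    have h5 : ∀ l, r l * (algebraMap k Kb (D.tt i j l) * r l / (r i * r j)) =
      (algebraMap k Kb (D.tt i j l) * (r l * r l)) * (r i * r j)⁻¹ := by intro l; ring
    simp only [h5]
    rw [← Finset.sum_mul, ← h4]
    field_simp
  have hz : Matrix.vecMul r (cK.mapMatrix (∑ i, A i * (A i).transpose)) = 0 := by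
    rw [map_sum, Matrix.vecMul_sum]
    have : ∀ i, Matrix.vecMul r (cK.mapMatrix (A i * (A i).transpose)) = (r i * r i) • r := by
      intro i
      rw [← hAst, map_mul, ← Matrix.vecMul_vecMul, hrow, Matrix.smul_vecMul, hrow, hrst, smul_smul]
    simp only [this]
    rw [← Finset.sum_smul]
    simp only [← hr]
    rw [← map_sum, hmu, map_zero, zero_smul]
  have hd2 : (cK.mapMatrix (∑ i, A i * (A i).transpose)).det = 0 := by
    apply Matrix.exists_vecMul_eq_zero_iff.1
    refine ⟨r, ?_, hz⟩
    intro h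
    exact hr0 D.i0 (congrFun h D.i0)
  rw [← RingHom.map_det, map_eq_zero] at hd2
  exact hdet hd2

lemma mu_one_ne : D.mu 1 ≠ 0 := by
  have : CharZero (AlgebraicClosure k) :=
    charZero_of_injective_algebraMap (algebraMap k (AlgebraicClosure k)).injective
  exact D.mu_one_ne_aux (AlgebraicClosure k)

lemma g_one : D.g = 1 := by
  apply dual_ext (k := k)
  intro f
  have := congrArg (fun f => f (1 : H)) (D.conv_mu f)
  simp [conv_one_apply] at this
  exact (this.resolve_right D.mu_one_ne).symm

lemma S_u : S D.u = D.u := by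
  have h := congrArg (fun x => x * D.u) D.g_one
  simpa [g, mul_assoc, y_u] using h

lemma conj_symm (a : H) : D.u * a * D.y = S (S a) := by
  have h := D.K_comm (D.y * a * D.y)
  rw [K, S_u] at h
  rw [D.S2]
  simp only [mul_assoc, u_y_mul] at h
  have h2 := congrArg (fun x => x * D.u) h
  simp only [mul_assoc, y_u, mul_one, y_u_mul] at h2
  rw [← mul_assoc] at h
  have h3 := D.K_comm (D.y * a)
  rw [K, S_u] at h3
  have h4 := congrArg (fun x => x * D.y) h3
  simp only [mul_assoc, u_y_mul, u_y, mul_one] at h4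
  rw [mul_assoc, mul_assoc, h4]

/-- sigma -/
noncomputable def sg (D : SD k H ι) : H →ₗ[k] H := S ∘ₗ S

lemma sg_sg : D.sg ∘ₗ D.sg = LinearMap.id := by
  ext a
  simp only [sg, LinearMap.comp_apply, LinearMap.id_apply]
  rw [← D.conj_symm, D.S2]
  simp only [mul_assoc, u_y_mul, u_y, mul_one]

lemma trace_sg_P (f : Module.Dual k H) :
    LinearMap.trace k H (D.sg ∘ₗ P f) = f D.L * D.mu 1 := by
  have h := D.Q_trace D.u (D.sg ∘ₗ P f)
  rw [u_y, LinearMap.mulRight_one, LinearMap.id_comp] at h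
  rw [← h]
  have h1 : ∑ i ∈ (ℛ k D.L).index, P f ((ℛ k D.L).left i) * S ((ℛ k D.L).right i) =
      f D.L • (1 : H) := by
    have h2 := comul_P f D.L
    rw [← (ℛ k D.L).eq, map_sum] at h2
    have h3 := congrArg (LinearMap.mul' k H ∘ₗ (S).lTensor H) h2
    have h4 := congrArg (fun φ => φ (P f D.L)) (HopfAlgebra.mul_antipode_lTensor_comul (R := k) (A := H))
    simp only [LinearMap.comp_apply] at h3 h4
    rw [h4] at h3
    simp only [LinearMap.rTensor_tmul, map_sum, LinearMap.lTensor_tmul, LinearMap.mul'_apply] at h3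
    rw [← h3]
    simp [counit_P, Algebra.algebraMap_eq_smul_one]
  have h5 : D.t (D.u * D.Q (D.sg ∘ₗ P f)) = D.t (D.u *
      ∑ i ∈ (ℛ k D.L).index, P f ((ℛ k D.L).left i) * S ((ℛ k D.L).right i)) := by
    simp only [Q, Finset.mul_sum, map_sum]
    refine Finset.sum_congr rfl fun i _ => ?_
    have : (D.sg ∘ₗ P f) ((ℛ k D.L).left i) = D.u * P f ((ℛ k D.L).left i) * D.y := by
      rw [conj_symm]; rfl
    rw [this, t, th_comm]
    simp only [mul_assoc, y_u, mul_one]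
    rw [th_comm]
    simp only [mul_assoc]
  rw [h5, h1]
  simp [mu]

lemma P_sg (f : Module.Dual k H) (hf : f ∘ₗ D.sg = f) : P f ∘ₗ D.sg = D.sg ∘ₗ P f := by
  ext a
  simp only [LinearMap.comp_apply, sg, P, LinearEquiv.coe_coe, comul_antipode_sq]
  rw [← (ℛ k a).eq]
  simp only [map_sum, TensorProduct.map_tmul, LinearMap.rTensor_tmul, TensorProduct.lid_tmul, map_smul]
  refine Finset.sum_congr rfl fun i _ => ?_
  have := congrArg (fun φ => φ ((ℛ k a).left i)) hf
  simp only [sg, LinearMap.comp_apply] at this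
  simp only [LinearMap.comp_apply]
  rw [this]

lemma trace_sg : LinearMap.trace k H D.sg = D.mu 1 := by
  have := D.trace_sg_P ε
  rw [P_counit, LinearMap.comp_id, counit_L, one_mul] at this
  exact this

lemma mu_int : ∃ n : ℤ, |n| ≤ Module.finrank k H ∧ D.mu 1 = n := by
  obtain ⟨n, hn, h⟩ := trace_cube (K := k) D.sg 1 1 one_ne_zero (by simp) (by
    rw [sg_sg, LinearMap.comp_id, one_smul])
  refine ⟨n, hn, ?_⟩
  rw [trace_sg] at h
  simpa using h

end SD
end D
end HopfAux

open Finset TensorProduct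
set_option linter.unusedSectionVars false
set_option linter.unusedSimpArgs false
set_option linter.unusedVariables false
namespace HopfAux
open Coalgebra HopfAlgebra WithConv

section D
variable {k H ι : Type*} [Field k] [Ring H] [HopfAlgebra k H] [Fintype ι] [DecidableEq ι]

local notation "S" => HopfAlgebra.antipode (A := H) k
local notation "Δ" => Coalgebra.comul (R := k) (A := H)
local notation "ε" => Coalgebra.counit (R := k) (A := H)

namespace SD
variable [CharZero k] [FiniteDimensional k H] (D : SD k H ι)

lemma c_conv (i j : ι) : conv k H (D.c i) (D.c j) = ∑ l, (D.N i j l : k) • D.c l := D.hN i j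

lemma c_c_L' (i j : ι) : conv k H (D.c i) (D.c j) D.L = if j = D.st i then 1 else 0 := by
  have := D.c_c_L i (D.st j)
  rw [st_st] at this
  rw [this]
  congr 1
  rw [eq_iff_iff]
  constructor
  · rintro rfl; rw [st_st]
  · rintro rfl; rw [st_st]

lemma c_symm (i j : ι) : conv k H (D.c i) (D.c j) D.L = conv k H (D.c j) (D.c i) D.L := by
  rw [c_c_L', c_c_L']
  congr 1
  rw [eq_iff_iff]
  constructor
  · rintro rfl; rw [st_st]
  · rintro rfl; rw [st_st]

lemma N_c (i j l : ι) : conv k H (conv k H (D.c i) (D.c j)) (D.c (D.st l)) D.L = D.N i j l := by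
  rw [c_conv, conv_sum_left, LinearMap.sum_apply]
  simp only [conv_smul_left, LinearMap.smul_apply, c_c_L', st_inj]
  simp

lemma c_cyc (i j l : ι) : conv k H (conv k H (D.c i) (D.c j)) (D.c l) D.L =
    conv k H (conv k H (D.c j) (D.c l)) (D.c i) D.L := by
  rw [conv_assoc, D.c_conv j l, conv_sum_left, conv_sum_right, LinearMap.sum_apply, LinearMap.sum_apply]
  simp only [conv_smul_left, conv_smul_right, LinearMap.smul_apply, D.c_symm i]

lemma c_star (i j l : ι) : conv k H (conv k H (D.c i) (D.c j)) (D.c l) D.L =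
    conv k H (conv k H (D.c (D.st l)) (D.c (D.st j))) (D.c (D.st i)) D.L := by
  have hc : ∀ i, D.c (D.st i) = D.c i ∘ₗ S := D.hst
  have : conv k H (D.c i) (D.c j) ∘ₗ S = conv k H (D.c (D.st j)) (D.c (D.st i)) := by
    ext a; rw [LinearMap.comp_apply, conv_antipode, hc, hc]
  rw [← D.S_L, conv_antipode, S_L, this, ← hc, conv_assoc]

lemma N_cyc (i j l : ι) : D.N i j l = D.N j (D.st l) (D.st i) := by
  have : (D.N i j l : k) = D.N j (D.st l) (D.st i) := by
    rw [← N_c, ← N_c, c_cyc, st_st]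
  exact_mod_cast this

lemma N_star (i j l : ι) : D.N i j l = D.N (D.st j) (D.st i) (D.st l) := by
  have : (D.N i j l : k) = D.N (D.st j) (D.st i) (D.st l) := by
    rw [← N_c, ← N_c, c_star, st_st, c_cyc]
  exact_mod_cast this

lemma N_symm (i j l : ι) : D.N (D.st i) l j = D.N i j l := by
  rw [D.N_cyc (D.st i), D.N_star i, st_st, N_cyc]

lemma N_ext {a b : ι → k} (h : ∑ i, a i • D.c i = ∑ i, b i • D.c i) : a = b := ch_li D.W D.hd h

lemma N_one_left (j l : ι) : D.N D.i0 j l = if l = j then 1 else 0 := by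
  have h := D.hN D.i0 j
  rw [D.h0, conv_counit_left] at h
  have h2 : D.c j = ∑ l, (if l = j then (1 : k) else 0) • D.c l := by simp
  have h3 := congrFun (D.N_ext (h.symm.trans h2)) l
  split_ifs with hl
  · simp [hl] at h3; rw [hl]; exact_mod_cast h3
  · simp [hl] at h3; exact_mod_cast h3

lemma N_one_right (j l : ι) : D.N j D.i0 l = if l = j then 1 else 0 := by
  rw [N_star, st_i0, N_one_left]
  simp [st_inj]

lemma N_assoc (i j m l : ι) : ∑ p, D.N i j p * D.N p m l = ∑ p, D.N j m p * D.N i p l := by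
  have h := conv_assoc (D.c i) (D.c j) (D.c m)
  rw [D.c_conv i j, D.c_conv j m, conv_sum_left, conv_sum_right] at h
  simp only [conv_smul_left, conv_smul_right, c_conv, Finset.smul_sum, smul_smul] at h
  rw [Finset.sum_comm, Finset.sum_comm (s := Finset.univ) (t := Finset.univ)
    (f := fun x y => ((D.N j m x : k) * D.N i x y) • D.c y)] at h
  simp only [← Finset.sum_smul] at h
  have h2 := congrFun (D.N_ext h) l
  exact_mod_cast h2

lemma N_dim (i j : ι) : D.d i * D.d j = ∑ l, D.N i j l * D.d l := by
  have h := congrArg (fun f => f (1 : H)) (D.c_conv i j)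
  simp only [conv_one_apply, c, ch_one, LinearMap.sum_apply, LinearMap.smul_apply, smul_eq_mul] at h
  exact_mod_cast h

/-- left multiplication matrices -/
def M (R : Type*) [CommRing R] (i : ι) : Matrix ι ι R := Matrix.of fun l j => (D.N i j l : R)

variable (R : Type*) [CommRing R]

lemma M_st (i : ι) : D.M R (D.st i) = (D.M R i).transpose := by
  ext l j
  simp only [M, Matrix.of_apply, Matrix.transpose_apply, N_symm]

lemma M_i0 : D.M R D.i0 = 1 := by
  ext l j
  simp [M, N_one_left, Matrix.one_apply]

lemma M_mul (i j : ι) : D.M R i * D.M R j = ∑ p, (D.N i j p : R) • D.M R p := by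
  ext l m
  simp only [Matrix.mul_apply, M, Matrix.of_apply, Matrix.sum_apply, Matrix.smul_apply, smul_eq_mul]
  have := congrArg (Nat.cast (R := R)) (D.N_assoc i j m l)
  push_cast at this
  rw [this]
  exact Finset.sum_congr rfl fun p _ => mul_comm _ _

lemma Z_eq (Z : Matrix ι ι ℤ)
    (hZ : ∀ j, conv k H (∑ i, conv k H (D.c i) (D.c (D.st i))) (D.c j) =
      ∑ l, ((Z l j : ℤ) : k) • D.c l) : Z = ∑ i, D.M ℤ i * D.M ℤ (D.st i) := by
  ext l j
  have h := hZ j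
  rw [conv_sum_left] at h
  simp only [conv_assoc] at h
  simp only [c_conv, conv_sum_right, conv_smul_right, Finset.smul_sum, smul_smul] at h
  have h2 : ∑ i, ∑ p, ∑ l, ((D.N (D.st i) j p : k) * D.N i p l) • D.c l =
      ∑ l, (∑ i, ∑ p, ((D.N (D.st i) j p : k) * D.N i p l)) • D.c l := by
    simp only [Finset.sum_smul]
    refine Eq.trans (Finset.sum_congr rfl fun i _ => Finset.sum_comm) ?_
    rw [Finset.sum_comm]
  rw [h2] at h
  have h3 := congrFun (D.N_ext h) l
  have h4 : Z l j = ∑ i, ∑ p, ((D.N (D.st i) j p : ℤ) * D.N i p l) := by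
    exact_mod_cast h3.symm
  rw [h4]
  simp only [Matrix.sum_apply, Matrix.mul_apply, M, Matrix.of_apply]
  exact Finset.sum_congr rfl fun i _ => Finset.sum_congr rfl fun p _ => mul_comm _ _

/-- the adjoint class matrix over a ring -/
def ZR : Matrix ι ι R := ∑ i, D.M R i * D.M R (D.st i)

lemma M_map {R' : Type*} [CommRing R'] (φ : R →+* R') (i : ι) : φ.mapMatrix (D.M R i) = D.M R' i := by
  ext l j; simp [M]

lemma ZR_map {R' : Type*} [CommRing R'] (φ : R →+* R') : φ.mapMatrix (D.ZR R) = D.ZR R' := by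
  simp only [ZR, map_sum, map_mul, M_map]

/-- left multiplication by a vector -/
def Lf (v : ι → R) : Matrix ι ι R := ∑ l, v l • D.M R l

lemma M_col (i : ι) : (D.M R i).mulVec (Pi.single D.i0 1) = Pi.single i 1 := by
  ext l
  simp [M, N_one_right, Pi.single_apply]

lemma Lf_col (v : ι → R) : (D.Lf R v).mulVec (Pi.single D.i0 1) = v := by
  rw [Lf, Matrix.sum_mulVec]
  simp only [Matrix.smul_mulVec, M_col]
  ext l
  simp [Finset.sum_apply, Pi.single_apply]

lemma M_mul_Lf (i : ι) (w : ι → R) : D.M R i * D.Lf R w = D.Lf R ((D.M R i).mulVec w) := by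
  simp only [Lf, Finset.mul_sum, mul_smul_comm, M_mul, Finset.smul_sum, smul_smul]
  rw [Finset.sum_comm]
  refine Finset.sum_congr rfl fun p _ => ?_
  rw [← Finset.sum_smul]
  congr 1
  simp [Matrix.mulVec, dotProduct, M, mul_comm]

lemma Lf_add (v w : ι → R) : D.Lf R (v + w) = D.Lf R v + D.Lf R w := by
  simp [Lf, add_smul, Finset.sum_add_distrib]
lemma Lf_smul (a : R) (w : ι → R) : D.Lf R (a • w) = a • D.Lf R w := by
  simp [Lf, Finset.smul_sum, smul_smul]
lemma Lf_sum {κ : Type*} (s : Finset κ) (w : κ → ι → R) : D.Lf R (∑ x ∈ s, w x) = ∑ x ∈ s, D.Lf R (w x) := by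
  classical
  induction s using Finset.induction_on with
  | empty => simp [Lf]
  | insert a s ha ih => rw [Finset.sum_insert ha, Finset.sum_insert ha, Lf_add, ih]

lemma Lf_mul (v w : ι → R) : D.Lf R v * D.Lf R w = D.Lf R ((D.Lf R v).mulVec w) := by
  conv_lhs => rw [Lf, Finset.sum_mul]
  simp only [smul_mul_assoc, M_mul_Lf, ← Lf_smul]
  rw [← Lf_sum]
  congr 1
  rw [Lf, Matrix.sum_mulVec]
  simp only [Matrix.smul_mulVec]

lemma M_eq_Lf (i : ι) : D.M R i = D.Lf R (Pi.single i 1) := by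
  simp [Lf, Pi.single_apply]

/-- being a left multiplication -/
def IsL (A : Matrix ι ι R) : Prop := ∃ v, A = D.Lf R v

lemma IsL_mul {A B : Matrix ι ι R} (hA : D.IsL R A) (hB : D.IsL R B) : D.IsL R (A * B) := by
  obtain ⟨v, rfl⟩ := hA; obtain ⟨w, rfl⟩ := hB
  exact ⟨_, D.Lf_mul R v w⟩

lemma IsL_ZR : D.IsL R (D.ZR R) := by
  refine ⟨∑ i, (D.M R i).mulVec (Pi.single (D.st i) 1), ?_⟩
  rw [Lf_sum, ZR]
  refine Finset.sum_congr rfl fun i _ => ?_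
  rw [D.M_eq_Lf R (D.st i), M_mul_Lf]

lemma IsL_aeval (q : Polynomial R) : D.IsL R (Polynomial.aeval (D.ZR R) q) := by
  induction q using Polynomial.induction_on' with
  | add p q hp hq =>
    obtain ⟨v, hv⟩ := hp; obtain ⟨w, hw⟩ := hq
    exact ⟨v + w, by rw [map_add, hv, hw, Lf_add]⟩
  | monomial n a =>
    rw [Polynomial.aeval_monomial, ← Algebra.smul_def]
    have : ∀ n, D.IsL R (D.ZR R ^ n) := by
      intro n
      induction n with
      | zero => exact ⟨Pi.single D.i0 1, by rw [← M_eq_Lf, M_i0, pow_zero]⟩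
      | succ n ih => rw [pow_succ]; exact D.IsL_mul R ih (D.IsL_ZR R)
    obtain ⟨v, hv⟩ := this n
    exact ⟨a • v, by rw [hv, Lf_smul]⟩

lemma trace_M (l : ι) : (D.M R l).trace = D.ZR R D.i0 l := by
  simp only [Matrix.trace, Matrix.diag_apply, M, Matrix.of_apply, ZR, Matrix.sum_apply,
    Matrix.mul_apply]
  have h : ∀ i p, D.N i p D.i0 = if p = D.st i then 1 else 0 := by
    intro i p
    have := D.N_i0 i (D.st p)
    rw [st_st] at this
    rw [this]
    congr 1
    rw [eq_iff_iff]
    constructor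
    · rintro rfl; rw [st_st]
    · rintro rfl; rw [st_st]
  simp only [h]
  simp
  refine Finset.sum_congr rfl fun i _ => ?_
  rw [D.N_cyc (D.st i), st_st]
  
lemma trace_Lf (v : ι → R) : (D.Lf R v).trace = (D.ZR R).mulVec v D.i0 := by
  rw [Lf, Matrix.trace_sum]
  simp only [Matrix.trace_smul, trace_M, smul_eq_mul, Matrix.mulVec, dotProduct, mul_comm]

end SD
end D
end HopfAux

open Finset TensorProduct
set_option linter.unusedSectionVars false
set_option linter.unusedSimpArgs false
set_option linter.unusedVariables false
namespace HopfAux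
open Coalgebra HopfAlgebra WithConv

lemma aeval_mulVec {n K : Type*} [Fintype n] [DecidableEq n] [Field K] (A : Matrix n n K)
    (w : n → K) (c : K) (h : A.mulVec w = c • w) (p : Polynomial K) :
    (Polynomial.aeval A p).mulVec w = p.eval c • w := by
  induction p using Polynomial.induction_on' with
  | add p q hp hq => rw [map_add, Matrix.add_mulVec, hp, hq, Polynomial.eval_add, add_smul]
  | monomial m a =>
    rw [Polynomial.aeval_monomial, ← Algebra.smul_def, Matrix.smul_mulVec, Polynomial.eval_monomial,
      mul_smul]
    congr 1
    induction m with
    | zero => simp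
    | succ m ih => rw [pow_succ, ← Matrix.mulVec_mulVec, h, Matrix.mulVec_smul, ih, smul_smul, pow_succ, mul_comm]

lemma sym_sq_zero {n : Type*} [Fintype n] [DecidableEq n] (A : Matrix n n ℚ)
    (hs : A.transpose = A) (h : A * A = 0) : A = 0 := by
  ext i j
  have h1 := congrFun (congrFun h j) j
  rw [Matrix.mul_apply] at h1
  have h2 : ∑ x, A x j * A x j = 0 := by
    rw [Matrix.zero_apply] at h1
    rw [← h1]
    refine Finset.sum_congr rfl fun x _ => ?_
    have : A x j = A j x := by conv_lhs => rw [← hs, Matrix.transpose_apply]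
    rw [this]
  have := (Finset.sum_eq_zero_iff_of_nonneg (fun x _ => mul_self_nonneg (A x j))).1 h2 i (Finset.mem_univ _)
  simpa using this

lemma sym_sep {n : Type*} [Fintype n] [DecidableEq n] (A : Matrix n n ℚ)
    (hs : A.transpose = A) : (minpoly ℚ A).Separable := by
  rw [PerfectField.separable_iff_squarefree]
  rintro p ⟨q, hq⟩
  have hm : minpoly ℚ A ≠ 0 := minpoly.ne_zero (Matrix.isIntegral A)
  have hsa : ∀ r : Polynomial ℚ, (Polynomial.aeval A r).transpose = Polynomial.aeval A r := by
    intro r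
    induction r using Polynomial.induction_on' with
    | add p q hp hq => rw [map_add, Matrix.transpose_add, hp, hq]
    | monomial m a =>
      rw [Polynomial.aeval_monomial, ← Algebra.smul_def, Matrix.transpose_smul, Matrix.transpose_pow, hs]
  have h0 : Polynomial.aeval A (p * q) = 0 := by
    apply sym_sq_zero _ (hsa _)
    rw [← map_mul, show p * q * (p * q) = minpoly ℚ A * q by rw [hq]; ring, map_mul, minpoly.aeval,
      zero_mul]
  have h1 := minpoly.dvd ℚ A h0
  rw [hq, mul_assoc] at h1
  have hpq : p * q ≠ 0 := by
    rintro h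
    rw [mul_assoc, h, mul_zero] at hq
    exact hm hq
  obtain ⟨t, ht⟩ := h1
  have : p * t = 1 := by
    apply mul_left_cancel₀ hpq
    rw [mul_one]
    conv_rhs => rw [ht]
    ring
  exact IsUnit.of_mul_eq_one _ this

section D
variable {k H ι : Type*} [Field k] [Ring H] [HopfAlgebra k H] [Fintype ι] [DecidableEq ι]

local notation "S" => HopfAlgebra.antipode (A := H) k
local notation "Δ" => Coalgebra.comul (R := k) (A := H)
local notation "ε" => Coalgebra.counit (R := k) (A := H)

namespace SD
variable [CharZero k] [FiniteDimensional k H] (D : SD k H ι)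
variable (K : Type*) [Field K] [CharZero K] [Algebra k K]

/-- matrix over K of an endomorphism -/
noncomputable def mt (f : H →ₗ[k] H) :
    Matrix (Fin (Module.finrank k H)) (Fin (Module.finrank k H)) K :=
  (algebraMap k K).mapMatrix (LinearMap.toMatrix (Module.finBasis k H) (Module.finBasis k H) f)

lemma mt_comp (f g : H →ₗ[k] H) : mt K (f ∘ₗ g) = mt K f * mt K g := by
  rw [mt, mt, mt, LinearMap.toMatrix_comp _ (Module.finBasis k H), map_mul]

lemma mt_id : mt K (LinearMap.id : H →ₗ[k] H) = 1 := by
  rw [mt, LinearMap.toMatrix_id, map_one]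

lemma mt_smul (a : k) (f : H →ₗ[k] H) : mt K (a • f) = algebraMap k K a • mt K f := by
  ext i j; simp [mt]

lemma mt_sum {κ : Type*} (s : Finset κ) (f : κ → H →ₗ[k] H) : mt K (∑ x ∈ s, f x) = ∑ x ∈ s, mt K (f x) := by
  simp [mt, map_sum]

lemma trace_mt (f : H →ₗ[k] H) : (mt K f).trace = algebraMap k K (LinearMap.trace k H f) := by
  rw [LinearMap.trace_eq_matrix_trace k (Module.finBasis k H), mt]
  simp [Matrix.trace]

/-- action of the character ring -/
noncomputable def PP (v : ι → K) : Matrix (Fin (Module.finrank k H)) (Fin (Module.finrank k H)) K :=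
  ∑ l, v l • mt K (P (D.c l))

lemma mt_conv (i j : ι) : mt K (P (D.c j)) * mt K (P (D.c i)) = ∑ l, (D.N i j l : K) • mt K (P (D.c l)) := by
  rw [← mt_comp, ← P_conv, c_conv, P_sum, mt_sum]
  refine Finset.sum_congr rfl fun l _ => ?_
  rw [P_smul, mt_smul, map_natCast]

lemma PP_mul (v w : ι → K) : D.PP K w * D.PP K v = D.PP K ((D.Lf K v).mulVec w) := by
  simp only [PP, Finset.sum_mul, Finset.mul_sum, smul_mul_smul_comm, mt_conv, Finset.smul_sum, smul_smul]
  refine Eq.trans (Finset.sum_congr rfl fun i _ => Finset.sum_comm) ?_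
  rw [Finset.sum_comm]
  refine Finset.sum_congr rfl fun l _ => ?_
  simp only [← Finset.sum_smul]
  congr 1
  simp only [Lf, Matrix.mulVec, dotProduct, Matrix.sum_apply, Matrix.smul_apply, M, Matrix.of_apply,
    Finset.sum_mul, smul_eq_mul]
  rw [Finset.sum_comm]
  refine Finset.sum_congr rfl fun i _ => Finset.sum_congr rfl fun j _ => ?_
  ring

lemma SG_PP (v : ι → K) : mt K D.sg * D.PP K v = D.PP K v * mt K D.sg := by
  simp only [PP, Finset.sum_mul, Finset.mul_sum, smul_mul_assoc, mul_smul_comm, ← mt_comp]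
  refine Finset.sum_congr rfl fun l _ => ?_
  rw [P_sg]
  ext a
  exact D.c_S2 l a

lemma SG_SG : mt K D.sg * mt K D.sg = 1 := by
  rw [← mt_comp, sg_sg, mt_id]

lemma trace_SG_PP (v : ι → K) : (mt K D.sg * D.PP K v).trace = v D.i0 * algebraMap k K (D.mu 1) := by
  simp only [PP, Finset.mul_sum, mul_smul_comm, ← mt_comp, Matrix.trace_sum, Matrix.trace_smul,
    trace_mt, trace_sg_P, c_L, smul_eq_mul]
  rw [Finset.sum_eq_single D.i0] <;> simp +contextual

lemma key_int (v : ι → K) (c : K) (hc : c ≠ 0) (h : (D.Lf K v).mulVec v = c • v) :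
    ∃ s : ℤ, v D.i0 * algebraMap k K (D.mu 1) = c * s := by
  have h1 : D.PP K v * D.PP K v = c • D.PP K v := by
    rw [PP_mul, h]
    simp [PP, Finset.smul_sum, smul_smul]
  have h2 : (mt K D.sg * D.PP K v) * (mt K D.sg * D.PP K v) = c • D.PP K v := by
    rw [← h1]
    calc _ = mt K D.sg * (D.PP K v * mt K D.sg) * D.PP K v := by simp only [mul_assoc]
      _ = (mt K D.sg * mt K D.sg) * (D.PP K v * D.PP K v) := by rw [← SG_PP]; simp only [mul_assoc]
      _ = _ := by rw [SG_SG, one_mul]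
  have h3 : (mt K D.sg * D.PP K v) * (mt K D.sg * D.PP K v) * (mt K D.sg * D.PP K v) =
      (c * c) • (mt K D.sg * D.PP K v) := by
    rw [h2, smul_mul_assoc, ← mul_assoc, ← SG_PP, mul_assoc, h1, mul_smul_comm, smul_smul]
  obtain ⟨s, _, hs⟩ := trace_cube_mat (c⁻¹ • (mt K D.sg * D.PP K v)) (by
    rw [smul_mul_smul_comm, smul_mul_smul_comm, h3, smul_smul]
    congr 1
    field_simp)
  refine ⟨s, ?_⟩
  rw [Matrix.trace_smul, trace_SG_PP, smul_eq_mul] at hs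
  rw [← hs]
  field_simp

lemma ZR_sym (R : Type*) [CommRing R] : (D.ZR R).transpose = D.ZR R := by
  simp only [ZR, Matrix.transpose_sum, Matrix.transpose_mul, M_st, Matrix.transpose_transpose]

lemma eig_rat (c : K) (w : ι → K) (hw : w ≠ 0) (h : (D.ZR K).mulVec w = c • w) :
    ∃ a : ℚ, c = a := by
  by_cases hc0 : c = 0
  · exact ⟨0, by simp [hc0]⟩
  set m := minpoly ℚ (D.ZR ℚ) with hm
  have hsep : m.Separable := sym_sep _ (D.ZR_sym ℚ)
  set mK := m.map (algebraMap ℚ K) with hmK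
  have hsepK : mK.Separable := hsep.map
  have hZm : Polynomial.aeval (D.ZR K) mK = 0 := by
    rw [hmK, Polynomial.aeval_map_algebraMap, ← D.ZR_map ℚ (algebraMap ℚ K)]
    have h1 : (algebraMap ℚ K).mapMatrix (D.ZR ℚ) = (Algebra.ofId ℚ K).mapMatrix (D.ZR ℚ) := rfl
    rw [h1, Polynomial.aeval_algHom_apply, hm, minpoly.aeval, map_zero]
  have hmc : mK.eval c = 0 := by
    have h1 := aeval_mulVec _ w c h mK
    rw [hZm, Matrix.zero_mulVec] at h1
    exact (smul_eq_zero.1 h1.symm).resolve_right hw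
  obtain ⟨q, hq⟩ := Polynomial.dvd_iff_isRoot.2 hmc
  have hqc : q.eval c ≠ 0 := by
    have h1 := hsepK.eval₂_derivative_ne_zero (RingHom.id K) (x := c) (by simpa using hmc)
    rw [hq] at h1
    simpa [Polynomial.derivative_mul] using h1
  obtain ⟨g, hg⟩ := Polynomial.X_sub_C_dvd_sub_C_eval (a := c) (p := q)
  obtain ⟨v, hv⟩ := D.IsL_aeval K ((Polynomial.C (q.eval c)⁻¹) * q)
  have hE0 : D.Lf K v * D.Lf K v = D.Lf K v := by
    rw [← hv, ← map_mul]
    have h1 : (Polynomial.C (q.eval c)⁻¹) * q * ((Polynomial.C (q.eval c)⁻¹) * q) =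
      (Polynomial.C (q.eval c)⁻¹) * q + (Polynomial.C (q.eval c)⁻¹) ^ 2 * g * mK := by
      have h2 : q = Polynomial.C (q.eval c) + (Polynomial.X - Polynomial.C c) * g := by rw [← hg]; ring
      have h3 : Polynomial.C (q.eval c)⁻¹ * Polynomial.C (q.eval c) = 1 := by
        rw [← Polynomial.C_mul, inv_mul_cancel₀ hqc, Polynomial.C_1]
      rw [hq]
      generalize Polynomial.C (q.eval c)⁻¹ = u at *
      generalize Polynomial.C (q.eval c) = u' at *
      linear_combination (u ^ 2 * q) * h2 + u * q * h3
    rw [h1, map_add, map_mul _ _ mK, hZm, mul_zero, add_zero]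
  have hEw : (D.Lf K v).mulVec w = w := by
    rw [← hv, aeval_mulVec _ w c h]
    simp [hqc]
  have hZE : D.ZR K * D.Lf K v = c • D.Lf K v := by
    have h1 : Polynomial.aeval (D.ZR K) ((Polynomial.X - Polynomial.C c) * ((Polynomial.C (q.eval c)⁻¹) * q)) = 0 := by
      rw [show (Polynomial.X - Polynomial.C c) * ((Polynomial.C (q.eval c)⁻¹) * q) =
        (Polynomial.C (q.eval c)⁻¹) * mK by rw [hq]; ring, map_mul, hZm, mul_zero]
    rw [map_mul, hv, map_sub, Polynomial.aeval_X, Polynomial.aeval_C, sub_mul, sub_eq_zero,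
      ← Algebra.smul_def] at h1
    exact h1
  have hvv : (D.Lf K v).mulVec v = (1 : K) • v := by
    have h1 := congrArg (fun A => A.mulVec (Pi.single D.i0 1)) hE0
    simp only [← Matrix.mulVec_mulVec, Lf_col] at h1
    rw [h1, one_smul]
  have hZv : (D.ZR K).mulVec v = c • v := by
    have h1 := congrArg (fun A => A.mulVec (Pi.single D.i0 1)) hZE
    simp only [← Matrix.mulVec_mulVec, Lf_col, Matrix.smul_mulVec] at h1
    exact h1
  obtain ⟨r, _, hr, hr0⟩ := trace_idem _ hE0
  rw [trace_Lf, hZv, Pi.smul_apply, smul_eq_mul] at hr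
  have hrne : r ≠ 0 := by
    intro h
    rw [hr0 h, Matrix.zero_mulVec] at hEw
    exact hw hEw.symm
  obtain ⟨s, hs⟩ := D.key_int K v 1 one_ne_zero hvv
  obtain ⟨n, _, hn⟩ := D.mu_int
  have hn0 : (n : K) ≠ 0 := by
    intro h
    have : n = 0 := by exact_mod_cast h
    exact D.mu_one_ne (by rw [hn, this]; simp)
  rw [hn, map_intCast, one_mul] at hs
  have hv0 : v D.i0 ≠ 0 := by
    intro h
    rw [h, mul_zero] at hr
    exact hrne (by exact_mod_cast hr.symm)
  have hs0 : (s : K) ≠ 0 := by rw [← hs]; exact mul_ne_zero hv0 hn0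
  refine ⟨r * n / s, ?_⟩
  push_cast
  rw [← hr, ← hs]
  field_simp

lemma psi_int (ψ : ι → K) (h0 : ψ D.i0 = 1)
    (h : ∀ i j, ψ i * ψ j = ∑ l, (D.N i j l : K) * ψ l)
    (hc : ∑ i, ψ i * ψ (D.st i) ≠ 0) :
    ∃ s : ℤ, algebraMap k K (D.mu 1) = (∑ i, ψ i * ψ (D.st i)) * s := by
  have hM : ∀ i, (D.M K i).mulVec (fun l => ψ (D.st l)) = ψ i • (fun l => ψ (D.st l)) := by
    intro i
    ext l
    simp only [Matrix.mulVec, dotProduct, M, Matrix.of_apply, Pi.smul_apply, smul_eq_mul]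
    rw [mul_comm, h]
    refine (Equiv.sum_comp D.stE (fun j => (D.N (D.st l) i j : K) * ψ j)).symm.trans ?_ |>.symm
    refine Finset.sum_congr rfl fun j _ => ?_
    have : D.N (D.st l) i (D.st j) = D.N i j l := by
      rw [D.N_cyc (D.st l) i, st_st, st_st]
    have h2 : D.stE j = D.st j := rfl
    rw [h2, this]
  have := D.key_int K (fun l => ψ (D.st l)) _ hc (by
    rw [Lf, Matrix.sum_mulVec, Finset.sum_smul]
    refine Finset.sum_congr rfl fun i _ => ?_
    rw [Matrix.smul_mulVec, hM, smul_smul, mul_comm])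
  simpa [st_i0, h0] using this

lemma sum_dd : ∑ i, D.d i * D.d (D.st i) = Module.finrank k H := by
  rw [finrank_eq D.W]
  refine Finset.sum_congr rfl fun i _ => ?_
  rw [d_st, sq]

lemma fin_pos (D : SD k H ι) : 0 < Module.finrank k H := by
  rw [← D.sum_dd]
  exact Finset.sum_pos (fun i _ => Nat.mul_pos (D.hd _) (D.hd _)) ⟨D.i0, Finset.mem_univ _⟩

/-- trace of the square of the antipode is plus or minus the dimension -/
lemma mu_eq : ∃ n : ℤ, |n| = Module.finrank k H ∧ D.mu 1 = n := by
  obtain ⟨n, hn, h⟩ := D.mu_int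
  have hs := D.sum_dd
  have hs' : ∑ i, (D.d i : k) * (D.d (D.st i) : k) = (Module.finrank k H : k) := by
    rw [← hs]; push_cast; rfl
  obtain ⟨s, hs2⟩ := D.psi_int k (fun i => (D.d i : k)) (by simp [D.hd0])
    (by intro i j; exact_mod_cast D.N_dim i j) (by
      rw [hs']; exact_mod_cast D.fin_pos.ne')
  rw [hs', h] at hs2
  have h3 : n = (Module.finrank k H : ℤ) * s := by
    simp only [Algebra.algebraMap_self, RingHom.id_apply] at hs2
    exact_mod_cast hs2
  have hn0 : n ≠ 0 := by
    rintro rfl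
    exact D.mu_one_ne (by rw [h]; simp)
  refine ⟨n, le_antisymm hn ?_, h⟩
  exact Int.le_of_dvd (abs_pos.2 hn0) ((dvd_abs _ _).2 ⟨s, h3⟩)

end SD
end D
end HopfAux

open Finset TensorProduct
set_option linter.unusedSectionVars false
set_option linter.unusedSimpArgs false
set_option linter.unusedVariables false
namespace HopfAux
open Coalgebra HopfAlgebra WithConv

lemma common_eig {V κ K : Type*} [Field K] [IsAlgClosed K] [AddCommGroup V] [Module K V]
    [FiniteDimensional K V] (f : κ → Module.End K V) (hf : ∀ i j, f i * f j = f j * f i)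
    (s : Finset κ) : ∀ (U : Submodule K V), U ≠ ⊥ → (∀ i, ∀ x ∈ U, f i x ∈ U) →
      ∃ v ∈ U, v ≠ 0 ∧ ∀ i ∈ s, ∃ μ : K, f i v = μ • v := by
  classical
  induction s using Finset.induction_on with
  | empty =>
    intro U hU _
    obtain ⟨v, hv, hv0⟩ := Submodule.exists_mem_ne_zero_of_ne_bot hU
    exact ⟨v, hv, hv0, by simp⟩
  | insert a s ha ih =>
    intro U hU hinv
    have : Nontrivial U := (Submodule.nontrivial_iff_ne_bot).2 hU
    obtain ⟨μ, hμ⟩ := Module.End.exists_eigenvalue ((f a).restrict (hinv a))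
    obtain ⟨w, hw⟩ := hμ.exists_hasEigenvector
    have hw1 : f a w = μ • (w : V) := by
      have := congrArg (Subtype.val) hw.apply_eq_smul
      simpa using this
    have hw0 : (w : V) ≠ 0 := by
      intro h; exact hw.2 (Subtype.ext h)
    obtain ⟨v, hv, hv0, hvs⟩ := ih (U ⊓ Module.End.eigenspace (f a) μ) (by
      intro h
      have : (w : V) ∈ U ⊓ Module.End.eigenspace (f a) μ :=
        ⟨w.2, Module.End.mem_eigenspace_iff.2 hw1⟩
      rw [h] at this
      exact hw0 (by simpa using this)) (by
      rintro i x ⟨hx1, hx2⟩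
      refine ⟨hinv i x hx1, ?_⟩
      rw [SetLike.mem_coe, Module.End.mem_eigenspace_iff] at hx2 ⊢
      have h1 := congrArg (fun g => g x) (hf a i)
      simp only [Module.End.mul_apply] at h1
      rw [h1, hx2, map_smul])
    refine ⟨v, hv.1, hv0, ?_⟩
    intro i hi
    rcases Finset.mem_insert.1 hi with rfl | hi
    · exact ⟨μ, Module.End.mem_eigenspace_iff.1 hv.2⟩
    · exact hvs i hi

section D
variable {k H ι : Type*} [Field k] [Ring H] [HopfAlgebra k H] [Fintype ι] [DecidableEq ι]

namespace SD
variable [CharZero k] [FiniteDimensional k H] (D : SD k H ι)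

lemma root_iff (K : Type*) [Field K] [CharZero K] (c : K) :
    Polynomial.aeval c (D.ZR ℤ).charpoly = 0 ↔ ∃ w, w ≠ 0 ∧ (D.ZR K).mulVec w = c • w := by
  have h1 : (D.ZR K).charpoly = (D.ZR ℤ).charpoly.map (algebraMap ℤ K) := by
    rw [← D.ZR_map ℤ (algebraMap ℤ K), RingHom.mapMatrix_apply, Matrix.charpoly_map]
  have h2 : Polynomial.aeval c (D.ZR ℤ).charpoly = (D.ZR K).charpoly.eval c := by
    rw [h1, Polynomial.eval_map_algebraMap]
  rw [h2, Matrix.eval_charpoly]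
  rw [← Matrix.exists_mulVec_eq_zero_iff]
  refine exists_congr fun w => and_congr_right fun _ => ?_
  rw [Matrix.sub_mulVec, sub_eq_zero, eq_comm]
  have : (Matrix.scalar ι c).mulVec w = c • w := by
    ext i; simp [Matrix.scalar_apply, Matrix.mulVec_diagonal]
  rw [this]

lemma rat_of_root (Kb : Type*) [Field Kb] [CharZero Kb] [Algebra k Kb] [IsAlgClosed Kb]
    (c : ℂ) (h : Polynomial.aeval c (D.ZR ℤ).charpoly = 0) : ∃ a : ℚ, c = a := by
  have hmon : (D.ZR ℤ).charpoly.Monic := Matrix.charpoly_monic _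
  have hIntegral : IsIntegral ℚ c := (show IsIntegral ℤ c from ⟨_, hmon, h⟩).tower_top
  have hdvd : minpoly ℚ c ∣ (D.ZR ℤ).charpoly.map (algebraMap ℤ ℚ) := by
    apply minpoly.dvd
    rw [Polynomial.aeval_map_algebraMap, h]
  obtain ⟨c', hc'⟩ := IsAlgClosed.exists_aeval_eq_zero Kb (minpoly ℚ c)
    (minpoly.degree_pos hIntegral).ne'
  have h2 : Polynomial.aeval c' (D.ZR ℤ).charpoly = 0 := by
    rw [← Polynomial.aeval_map_algebraMap ℚ]
    obtain ⟨g, hg⟩ := hdvd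
    rw [hg, map_mul, hc', zero_mul]
  obtain ⟨w, hw, hw2⟩ := (D.root_iff Kb c').1 h2
  obtain ⟨a, rfl⟩ := D.eig_rat Kb c' w hw hw2
  have h3 : (minpoly ℚ c).IsRoot a := by
    have h4 : Polynomial.aeval (algebraMap ℚ Kb a) (minpoly ℚ c) = 0 := by
      rw [eq_ratCast]; exact hc'
    rw [Polynomial.aeval_algebraMap_apply, map_eq_zero] at h4
    simpa using h4
  have h5 := Polynomial.degree_eq_one_of_irreducible_of_root (minpoly.irreducible hIntegral) h3
  obtain ⟨b, hb⟩ := minpoly.mem_range_of_degree_eq_one ℚ c h5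
  exact ⟨b, by rw [← hb, eq_ratCast]⟩

lemma d_M (R : Type*) [CommRing R] (i : ι) :
    Matrix.vecMul (fun l => (D.d l : R)) (D.M R i) = (D.d i : R) • fun l => (D.d l : R) := by
  ext j
  simp only [Matrix.vecMul, dotProduct, M, Matrix.of_apply, Pi.smul_apply, smul_eq_mul]
  have := congrArg (Nat.cast (R := R)) (D.N_dim i j)
  push_cast at this
  rw [this]
  exact Finset.sum_congr rfl fun p _ => mul_comm _ _

lemma d_ZR (R : Type*) [CommRing R] :
    Matrix.vecMul (fun l => (D.d l : R)) (D.ZR R) =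
      (Module.finrank k H : R) • fun l => (D.d l : R) := by
  rw [ZR, Matrix.vecMul_sum, ← D.sum_dd]
  push_cast
  rw [Finset.sum_smul]
  refine Finset.sum_congr rfl fun i _ => ?_
  rw [← Matrix.vecMul_vecMul, d_M, Matrix.smul_vecMul, d_M, smul_smul]

lemma ZR_nonneg (l j : ι) : 0 ≤ D.ZR ℚ l j := by
  simp only [ZR, Matrix.sum_apply, Matrix.mul_apply, M, Matrix.of_apply]
  positivity

lemma eig_le (a : ℚ) (w : ι → ℚ) (hw : w ≠ 0) (h : (D.ZR ℚ).mulVec w = a • w) :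
    a ≤ Module.finrank k H := by
  have hpos : 0 < ∑ l, (D.d l : ℚ) * |w l| := by
    obtain ⟨l, hl⟩ := Function.ne_iff.1 hw
    refine Finset.sum_pos' (fun i _ => by positivity) ⟨l, Finset.mem_univ _, ?_⟩
    have := D.hd l
    have hl' : w l ≠ 0 := hl
    positivity
  have h1 : a * ∑ l, (D.d l : ℚ) * |w l| ≤ (Module.finrank k H : ℚ) * ∑ l, (D.d l : ℚ) * |w l| := by
    calc a * ∑ l, (D.d l : ℚ) * |w l| = ∑ l, (D.d l : ℚ) * (a * |w l|) := by
          rw [Finset.mul_sum]; exact Finset.sum_congr rfl fun l _ => by ring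
      _ ≤ ∑ l, (D.d l : ℚ) * ∑ j, D.ZR ℚ l j * |w j| := by
          refine Finset.sum_le_sum fun l _ => ?_
          refine mul_le_mul_of_nonneg_left ?_ (Nat.cast_nonneg _)
          have h2 : a * w l = ∑ j, D.ZR ℚ l j * w j := (congrFun h l).symm
          calc a * |w l| ≤ |a| * |w l| := mul_le_mul_of_nonneg_right (le_abs_self _) (abs_nonneg _)
            _ = |∑ j, D.ZR ℚ l j * w j| := by rw [← abs_mul, h2]
            _ ≤ ∑ j, |D.ZR ℚ l j * w j| := Finset.abs_sum_le_sum_abs _ _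
            _ = _ := by
              refine Finset.sum_congr rfl fun j _ => ?_
              rw [abs_mul, abs_of_nonneg (D.ZR_nonneg l j)]
      _ = ∑ j, (∑ l, (D.d l : ℚ) * D.ZR ℚ l j) * |w j| := by
          simp only [Finset.mul_sum, Finset.sum_mul]
          rw [Finset.sum_comm]
          exact Finset.sum_congr rfl fun l _ => Finset.sum_congr rfl fun j _ => by ring
      _ = _ := by
          rw [Finset.mul_sum]
          refine Finset.sum_congr rfl fun j _ => ?_
          have h2 : ∑ l, (D.d l : ℚ) * D.ZR ℚ l j = (Module.finrank k H : ℚ) * D.d j :=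
            congrFun (D.d_ZR ℚ) j
          rw [h2]; ring
  exact le_of_mul_le_mul_right h1 hpos

lemma eig_main (c : ℂ) (h : Polynomial.aeval c (D.ZR ℤ).charpoly = 0) :
    ∃ m : ℕ, 0 < m ∧ c = m ∧ m ≤ Module.finrank k H := by
  have : CharZero (AlgebraicClosure k) :=
    charZero_of_injective_algebraMap (algebraMap k (AlgebraicClosure k)).injective
  obtain ⟨a, rfl⟩ := D.rat_of_root (AlgebraicClosure k) c h
  have h1 : Polynomial.aeval a (D.ZR ℤ).charpoly = 0 := by
    have h2 : Polynomial.aeval (algebraMap ℚ ℂ a) (D.ZR ℤ).charpoly = 0 := by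
      rw [eq_ratCast]; exact h
    rwa [Polynomial.aeval_algebraMap_apply, map_eq_zero] at h2
  have hIntegral : IsIntegral ℤ a := ⟨_, Matrix.charpoly_monic _, h1⟩
  obtain ⟨z, hz⟩ := IsIntegrallyClosed.isIntegral_iff.1 hIntegral
  obtain ⟨w, hw, hw2⟩ := (D.root_iff ℚ a).1 h1
  have hle := D.eig_le a w hw hw2
  have hge : 1 ≤ a := pos_eig (D.M ℚ) D.i0 (D.M_i0 ℚ) w hw a (by
    simp only [← M_st]; exact hw2)
  rw [eq_intCast] at hz
  subst hz
  have hz1 : 1 ≤ z := by exact_mod_cast hge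
  obtain ⟨m, rfl⟩ := Int.eq_ofNat_of_zero_le (by omega : 0 ≤ z)
  exact ⟨m, by omega, by simp, by exact_mod_cast hle⟩

lemma root_dim (K : Type*) [Field K] [CharZero K] :
    Polynomial.aeval (Module.finrank k H : K) (D.ZR ℤ).charpoly = 0 := by
  have h1 : (D.ZR K).charpoly = (D.ZR ℤ).charpoly.map (algebraMap ℤ K) := by
    rw [← D.ZR_map ℤ (algebraMap ℤ K), RingHom.mapMatrix_apply, Matrix.charpoly_map]
  rw [← Polynomial.eval_map_algebraMap, ← h1, Matrix.eval_charpoly, ← Matrix.exists_vecMul_eq_zero_iff]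
  refine ⟨fun l => (D.d l : K), ?_, ?_⟩
  · intro h
    have := congrFun h D.i0
    simp [D.hd0] at this
  · rw [Matrix.vecMul_sub, d_ZR, sub_eq_zero]
    ext i; simp [Matrix.scalar_apply, Matrix.vecMul_diagonal, mul_comm]

lemma dvd_aux (Kb : Type*) [Field Kb] [CharZero Kb] [Algebra k Kb] [IsAlgClosed Kb]
    (hcomm : ∀ i j l, D.N i j l = D.N j i l) (m : ℕ) (hm : 0 < m)
    (h1 : Polynomial.aeval (m : ℤ) (D.ZR ℤ).charpoly = 0) : m ∣ Module.finrank k H := by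
  have h : Polynomial.aeval (m : Kb) (D.ZR ℤ).charpoly = 0 := by
    have h3 : Polynomial.aeval (algebraMap ℤ Kb m) (D.ZR ℤ).charpoly = 0 := by
      rw [Polynomial.aeval_algebraMap_apply, h1, map_zero]
    simpa using h3
  obtain ⟨w, hw, hw2⟩ := (D.root_iff Kb _).1 h
  have hMM : ∀ i j, D.M Kb i * D.M Kb j = D.M Kb j * D.M Kb i := by
    intro i j
    rw [M_mul, M_mul]
    exact Finset.sum_congr rfl fun p _ => by rw [hcomm]
  have hMZ : ∀ i, D.M Kb i * D.ZR Kb = D.ZR Kb * D.M Kb i := by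
    intro i
    rw [ZR, Finset.mul_sum, Finset.sum_mul]
    refine Finset.sum_congr rfl fun j _ => ?_
    rw [← mul_assoc, hMM i j, mul_assoc, hMM i, mul_assoc]
  obtain ⟨v, hvU, hv0, hv⟩ := common_eig (fun i => Matrix.toLin' (D.M Kb i)) (by
      intro i j
      simp only [← Matrix.toLin'_mul, Module.End.mul_eq_comp, hMM i j]) Finset.univ
    (Module.End.eigenspace (Matrix.toLin' (D.ZR Kb)) (m : Kb)) (by
      intro hb
      have : w ∈ Module.End.eigenspace (Matrix.toLin' (D.ZR Kb)) (m : Kb) := by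
        rw [Module.End.mem_eigenspace_iff, Matrix.toLin'_apply, hw2]
      rw [hb] at this
      exact hw (by simpa using this)) (by
      intro i x hx
      rw [Module.End.mem_eigenspace_iff, Matrix.toLin'_apply] at hx ⊢
      rw [Matrix.toLin'_apply, Matrix.mulVec_mulVec, ← hMZ, ← Matrix.mulVec_mulVec, hx,
        Matrix.mulVec_smul])
  rw [Module.End.mem_eigenspace_iff, Matrix.toLin'_apply] at hvU
  simp only [Finset.mem_univ, true_imp_iff, Matrix.toLin'_apply] at hv
  choose ψ hψ using hv
  have hcanc : ∀ a b : Kb, a • v = b • v → a = b := fun a b hab => smul_left_injective Kb hv0 hab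
  have hc : ∑ i, ψ i * ψ (D.st i) = m := by
    apply hcanc
    rw [← hvU, ZR, Matrix.sum_mulVec, Finset.sum_smul]
    refine Finset.sum_congr rfl fun i _ => ?_
    rw [← Matrix.mulVec_mulVec, hψ, Matrix.mulVec_smul, hψ, smul_smul, mul_comm]
  obtain ⟨s, hs⟩ := D.psi_int Kb ψ (by
      apply hcanc
      rw [← hψ, M_i0, Matrix.one_mulVec, one_smul]) (by
      intro i j
      apply hcanc
      have h1 := congrArg (fun A => A.mulVec v) (D.M_mul Kb i j)
      simp only [Matrix.sum_mulVec, Matrix.smul_mulVec, ← Matrix.mulVec_mulVec, hψ,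
        Matrix.mulVec_smul, smul_smul] at h1
      rw [← Finset.sum_smul, mul_comm] at h1
      exact h1) (by rw [hc]; exact_mod_cast hm.ne')
  obtain ⟨n, hn, hn2⟩ := D.mu_eq
  rw [hc, hn2, map_intCast] at hs
  have h3 : n = (m : ℤ) * s := by exact_mod_cast hs
  have h4 : (m : ℤ) ∣ |n| := (dvd_abs _ _).2 ⟨s, h3⟩
  rw [hn] at h4
  exact_mod_cast h4

lemma dvd_main (hcomm : ∀ i j l, D.N i j l = D.N j i l) (m : ℕ) (hm : 0 < m)
    (h : Polynomial.aeval (m : ℂ) (D.ZR ℤ).charpoly = 0) : m ∣ Module.finrank k H := by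
  have : CharZero (AlgebraicClosure k) :=
    charZero_of_injective_algebraMap (algebraMap k (AlgebraicClosure k)).injective
  refine D.dvd_aux (AlgebraicClosure k) hcomm m hm ?_
  have h1 : Polynomial.aeval (m : ℤ) (D.ZR ℤ).charpoly = 0 := by
    have h2 : Polynomial.aeval (algebraMap ℤ ℂ m) (D.ZR ℤ).charpoly = 0 := by
      simpa using h
    rw [Polynomial.aeval_algebraMap_apply, eq_intCast] at h2
    exact_mod_cast h2
  exact h1

end SD
end D
end HopfAux

/-- Let `H` be a split semisimple Hopf algebra over a field `k` of characteristic `0`: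
via Artin–Wedderburn, `H ≅ ∏_{i ∈ Irr H} M_{d i}(k)` as `k`-algebras, with irreducible
characters `χ i` and duality `χ (st i) = χ i ∘ S`. Let `N i j l` be the (natural number)
structure constants of the Grothendieck ring, `χ i * χ j = ∑ l N i j l χ l` (convolution
product), and let `Z` be the integer matrix of left multiplication by the adjoint class
`z = ∑ i [V_i][V_i*]` on `G₀(H)` in the basis of irreducibles. Then every eigenvalue of
`Z` is a positive integer at most `dim_k H`, the largest eigenvalue equals `dim_k H`,
and if `G₀(H)` is commutative then every eigenvalue divides `dim_k H`. -/
theorem stmt_18 (k : Type*) [Field k] [CharZero k]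
    (H : Type*) [Ring H] [HopfAlgebra k H] [FiniteDimensional k H]
    (ι : Type*) [Fintype ι] [DecidableEq ι]
    (d : ι → ℕ) (hd : ∀ i, 0 < d i)
    (W : H ≃ₐ[k] ((i : ι) → Matrix (Fin (d i)) (Fin (d i)) k))
    (χ : ι → Module.Dual k H)
    (hχ : ∀ i, χ i = (Matrix.traceLinearMap (Fin (d i)) k k).comp
      ((LinearMap.proj i).comp W.toLinearMap))
    (st : ι → ι)
    (hst : ∀ i, χ (st i) = (χ i).comp (HopfAlgebra.antipode (R := k)))
    (N : ι → ι → ι → ℕ)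
    (hN : ∀ i j, conv k H (χ i) (χ j) = ∑ l, (N i j l : k) • χ l)
    (Z : Matrix ι ι ℤ)
    (hZ : ∀ j, conv k H (∑ i, conv k H (χ i) (χ (st i))) (χ j) =
      ∑ l, ((Z l j : ℤ) : k) • χ l) :
    (∀ c : ℂ, Module.End.HasEigenvalue (Matrix.toLin' (Z.map (Int.cast : ℤ → ℂ))) c →
        ∃ m : ℕ, 0 < m ∧ c = (m : ℂ) ∧ m ≤ Module.finrank k H) ∧
    Module.End.HasEigenvalue (Matrix.toLin' (Z.map (Int.cast : ℤ → ℂ)))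
      ((Module.finrank k H : ℂ)) ∧
    ((∀ i j l, N i j l = N j i l) →
      ∀ c : ℂ, Module.End.HasEigenvalue (Matrix.toLin' (Z.map (Int.cast : ℤ → ℂ))) c →
        ∃ m : ℕ, c = (m : ℂ) ∧ m ∣ Module.finrank k H) := by
  obtain rfl : χ = HopfAux.ch W := funext hχ
  obtain ⟨i0, h0, hd0⟩ := HopfAux.exists_i0 W
  let D : HopfAux.SD k H ι := ⟨d, hd, W, st, hst, N, hN, i0, h0, hd0⟩
  have hZ' : Z = D.ZR ℤ := D.Z_eq Z hZ
  have hmap : Z.map (Int.cast : ℤ → ℂ) = D.ZR ℂ := by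
    rw [hZ', ← D.ZR_map ℤ (Int.castRingHom ℂ)]
    rfl
  have hev : ∀ c : ℂ, Module.End.HasEigenvalue (Matrix.toLin' (Z.map (Int.cast : ℤ → ℂ))) c ↔
      Polynomial.aeval c (D.ZR ℤ).charpoly = 0 := by
    intro c
    rw [D.root_iff ℂ c, hmap]
    constructor
    · intro h
      obtain ⟨w, hw⟩ := h.exists_hasEigenvector
      exact ⟨w, hw.2, by simpa using hw.apply_eq_smul⟩
    · rintro ⟨w, hw, hw2⟩
      exact Module.End.hasEigenvalue_of_hasEigenvector (x := w)
        ⟨Module.End.mem_eigenspace_iff.2 (by simpa using hw2), hw⟩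
  simp only [hev]
  refine ⟨D.eig_main, D.root_dim ℂ, ?_⟩
  intro hcomm c hc
  obtain ⟨m, hm, rfl, _⟩ := D.eig_main c hc
  exact ⟨m, rfl, D.dvd_main hcomm m hm hc⟩
end

section
/- Let H be a split semisimple Hopf algebra over a field k, and suppose the representation algebra R(H) = G_0(H) ⊗_ℤ k is semisimple. Then for every group-like element g ∈ H, the adjoint character χ_ad(g) = Σ_{V ∈ Irr H} χ_{V*}(g) χ_V(g) is nonzero. -/
open Finset TensorProduct

/-- The map `w ⊗ a ↦ (w ⊗ 1) Δ(a)`. -/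
noncomputable def galoisMap (k H : Type*) [Field k] [Ring H] [HopfAlgebra k H] :
    H ⊗[k] H →ₗ[k] H ⊗[k] H :=
  TensorProduct.lift
    (((LinearMap.mul k (H ⊗[k] H)).compl₂ (Coalgebra.comul (R := k) (A := H))).comp
      ((TensorProduct.mk k H H).flip 1))

lemma galoisMap_tmul (k H : Type*) [Field k] [Ring H] [HopfAlgebra k H] (w a : H) :
    galoisMap k H (w ⊗ₜ a) = (w ⊗ₜ[k] (1 : H)) * Coalgebra.comul (R := k) a := by
  simp [galoisMap]

lemma galoisMap_surj (k H : Type*) [Field k] [Ring H] [HopfAlgebra k H] :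
    Function.Surjective (galoisMap k H) := by
  intro x
  induction x using TensorProduct.induction_on with
  | zero => exact ⟨0, map_zero _⟩
  | add x y hx hy =>
    obtain ⟨a, rfl⟩ := hx
    obtain ⟨b, rfl⟩ := hy
    exact ⟨a + b, map_add _ _ _⟩
  | tmul w a =>
    let Ψ : H ⊗[k] (H ⊗[k] H) →ₗ[k] H ⊗[k] H :=
      (TensorProduct.map ((LinearMap.mulLeft k w).comp
        ((LinearMap.mul' k H).comp ((HopfAlgebra.antipode (R := k) (A := H)).rTensor H)))
        LinearMap.id).comp (TensorProduct.assoc k H H H).symm.toLinearMap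
    have h1 : ∀ t : H ⊗[k] H, galoisMap k H (TensorProduct.map ((LinearMap.mulLeft k w).comp
        (HopfAlgebra.antipode (R := k) (A := H))) LinearMap.id t) =
        Ψ ((Coalgebra.comul (R := k) (A := H)).lTensor H t) := by
      intro t
      induction t using TensorProduct.induction_on with
      | zero => simp
      | add x y hx hy => simp only [map_add, hx, hy]
      | tmul p q =>
        simp only [TensorProduct.map_tmul, galoisMap_tmul, LinearMap.lTensor_tmul]
        generalize (Coalgebra.comul (R := k) q) = D
        induction D using TensorProduct.induction_on with
        | zero => simp
        | add x y hx hy => simp only [map_add, mul_add, TensorProduct.tmul_add, hx, hy]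
        | tmul r s => simp [Ψ, mul_assoc]
    refine ⟨_, (h1 (Coalgebra.comul (R := k) a)).trans ?_⟩
    rw [← Coalgebra.coassoc_apply]
    have h2 : ∀ t : H ⊗[k] H, Ψ (TensorProduct.assoc k H H H
        ((Coalgebra.comul (R := k) (A := H)).rTensor H t)) =
        TensorProduct.map ((LinearMap.mulLeft k w).comp ((Algebra.linearMap k H).comp
          (Coalgebra.counit (R := k) (A := H)))) LinearMap.id t := by
      intro t
      induction t using TensorProduct.induction_on with
      | zero => simp
      | add x y hx hy => simp only [map_add, hx, hy]
      | tmul p q =>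
        simp only [Ψ, LinearMap.rTensor_tmul, LinearMap.comp_apply, LinearEquiv.coe_coe,
          LinearEquiv.symm_apply_apply, TensorProduct.map_tmul,
          HopfAlgebra.mul_antipode_rTensor_comul_apply, Algebra.linearMap_apply]
    rw [h2]
    have h3 : ∀ t : H ⊗[k] H, TensorProduct.map ((LinearMap.mulLeft k w).comp
          ((Algebra.linearMap k H).comp
          (Coalgebra.counit (R := k) (A := H)))) LinearMap.id t =
          w ⊗ₜ[k] (TensorProduct.lid k H
            ((Coalgebra.counit (R := k) (A := H)).rTensor H t)) := by
      intro t
      induction t using TensorProduct.induction_on with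
      | zero => simp
      | add x y hx hy => simp only [map_add, TensorProduct.tmul_add, hx, hy]
      | tmul p q =>
        simp [← Algebra.commutes, ← Algebra.smul_def, TensorProduct.smul_tmul]
    rw [h3, Coalgebra.rTensor_counit_comul]
    simp

/-- Trace of `x ↦ a x b`. -/
noncomputable def biTrace (k A : Type*) [Field k] [Ring A] [Algebra k A] (a b : A) : k :=
  LinearMap.trace k A ((LinearMap.mulLeft k a).comp (LinearMap.mulRight k b))

lemma biTrace_tmul (k H : Type*) [Field k] [Ring H] [Algebra k H] [FiniteDimensional k H]
    (a b c e : H) :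
    biTrace k (H ⊗[k] H) (a ⊗ₜ b) (c ⊗ₜ e) = biTrace k H a c * biTrace k H b e := by
  unfold biTrace
  rw [← smul_eq_mul, smul_eq_mul, ← LinearMap.trace_tensorProduct']
  congr 1
  ext x y
  simp

lemma biTrace_sum (k A : Type*) [Field k] [Ring A] [Algebra k A] (a : A) {κ : Type*}
    (s : Finset κ) (f : κ → A) :
    biTrace k A a (∑ i ∈ s, f i) = ∑ i ∈ s, biTrace k A a (f i) := by
  unfold biTrace
  rw [← map_sum]
  congr 1
  ext x
  simp [Finset.mul_sum]

lemma biTrace_comul (k H : Type*) [Field k] [Ring H] [HopfAlgebra k H] [FiniteDimensional k H]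
    (g s u b : H) (hs : Coalgebra.comul (R := k) s = s ⊗ₜ[k] s) (hgs : g * s = 1) :
    biTrace k (H ⊗[k] H) (u ⊗ₜ s) (Coalgebra.comul (R := k) b) =
      biTrace k H u g * biTrace k H s b := by
  rw [← biTrace_tmul]
  let e : (H ⊗[k] H) ≃ₗ[k] (H ⊗[k] H) := LinearEquiv.ofBijective (galoisMap k H)
    ⟨LinearMap.injective_iff_surjective.mpr (galoisMap_surj k H), galoisMap_surj k H⟩
  unfold biTrace
  rw [← LinearMap.trace_conj' ((LinearMap.mulLeft k (u ⊗ₜ[k] s)).comp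
    (LinearMap.mulRight k (g ⊗ₜ[k] b))) e]
  congr 1
  rw [LinearEquiv.conj_apply, ← LinearMap.comp_assoc]
  apply LinearMap.ext
  intro y
  obtain ⟨x, rfl⟩ := e.surjective y
  have he : ∀ x, e x = galoisMap k H x := fun _ => rfl
  simp only [LinearMap.comp_apply, LinearEquiv.coe_coe, LinearEquiv.symm_apply_apply,
    LinearMap.mulLeft_apply, LinearMap.mulRight_apply]
  simp only [he]
  induction x using TensorProduct.induction_on with
  | zero => simp
  | add x y hx hy => simp only [map_add, add_mul, mul_add, hx, hy]
  | tmul w a =>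
    simp only [galoisMap_tmul, Algebra.TensorProduct.tmul_mul_tmul, Bialgebra.comul_mul, hs]
    simp only [← mul_assoc, Algebra.TensorProduct.tmul_mul_tmul]
    simp only [mul_assoc, hgs, mul_one, one_mul]

lemma biTrace_eq (k : Type*) [Field k]
    (H : Type*) [Ring H] [Algebra k H]
    (ι : Type*) [Fintype ι] [DecidableEq ι]
    (d : ι → ℕ)
    (W : H ≃ₐ[k] ((i : ι) → Matrix (Fin (d i)) (Fin (d i)) k)) (a b : H) :
    biTrace k H a b = ∑ i, (W a i).trace * (W b i).trace := by
  let B := (Pi.basis (fun i => Matrix.stdBasis k (Fin (d i)) (Fin (d i)))).map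
    W.symm.toLinearEquiv
  unfold biTrace
  rw [LinearMap.trace_eq_matrix_trace k B, Matrix.trace, Fintype.sum_sigma]
  refine Finset.sum_congr rfl fun i _ => ?_
  rw [Fintype.sum_prod_type, Matrix.trace, Matrix.trace, Finset.sum_mul_sum]
  refine Finset.sum_congr rfl fun p _ => Finset.sum_congr rfl fun q _ => ?_
  have hB : W (B ⟨i, p, q⟩) = Pi.single i (Matrix.single p q 1) := by
    simp [B, Pi.basis_apply, Matrix.stdBasis_eq_single]
  have hr : ∀ x, B.repr x ⟨i, p, q⟩ = W x i p q := by
    intro x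
    simp [B, Pi.basis_repr, Matrix.stdBasis]
  rw [Matrix.diag_apply, LinearMap.toMatrix_apply, hr]
  simp only [LinearMap.comp_apply, LinearMap.mulLeft_apply, LinearMap.mulRight_apply, map_mul,
    hB, Pi.mul_apply, Pi.single_eq_same, Matrix.diag_apply]
  rw [← Matrix.mul_assoc, Matrix.mul_apply, Finset.sum_eq_single q]
  · simp
  · intro r _ hr
    simp [hr]
  · simp

/-- Let `H` be a split semisimple Hopf algebra over a field `k`
(`H ≅ ∏_{i ∈ Irr H} M_{d i}(k)`, with irreducible characters `χ i` and duality
`χ (st i) = χ i ∘ S`). Suppose the representation algebra `R(H)` — a `k`-algebra `RH`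
realized, via an injective multiplicative linear map `Φ`, as the span of the irreducible
characters inside the (convolution) dual of `H` — is semisimple. Then for every
group-like element `g ∈ H`, the adjoint character value
`χ_ad(g) = ∑ i χ_{i*}(g) χ_i(g)` is nonzero. -/
theorem stmt_19 (k : Type*) [Field k]
    (H : Type*) [Ring H] [HopfAlgebra k H] [FiniteDimensional k H]
    (ι : Type*) [Fintype ι] [DecidableEq ι]
    (d : ι → ℕ) (hd : ∀ i, 0 < d i)
    (W : H ≃ₐ[k] ((i : ι) → Matrix (Fin (d i)) (Fin (d i)) k))
    (χ : ι → Module.Dual k H)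
    (hχ : ∀ i, χ i = (Matrix.traceLinearMap (Fin (d i)) k k).comp
      ((LinearMap.proj i).comp W.toLinearMap))
    (st : ι → ι)
    (hst : ∀ i, χ (st i) = (χ i).comp (HopfAlgebra.antipode (R := k)))
    (RH : Type*) [Ring RH] [Algebra k RH] [IsSemisimpleRing RH]
    (Φ : RH →ₗ[k] Module.Dual k H)
    (hΦinj : Function.Injective Φ)
    (hΦmul : ∀ u v : RH, Φ (u * v) = conv k H (Φ u) (Φ v))
    (hΦone : Φ 1 = Coalgebra.counit (R := k))
    (hΦrange : LinearMap.range Φ = Submodule.span k (Set.range χ))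
    (g : H)
    (hg : Coalgebra.comul (R := k) g = g ⊗ₜ[k] g)
    (hg1 : Coalgebra.counit (R := k) g = 1) :
    (∑ i, χ (st i) g * χ i g) ≠ 0 := by
  classical
  have hχa : ∀ i a, χ i a = (W a i).trace := fun i a => by rw [hχ]; rfl
  have ht : ∀ a b, biTrace k H a b = ∑ i, χ i a * χ i b := fun a b => by
    rw [biTrace_eq k H ι d W]; simp only [hχa]
  let s : H := HopfAlgebra.antipode (R := k) g
  have hgs : g * s = 1 := by
    have := HopfAlgebra.mul_antipode_lTensor_comul_apply (R := k) g
    rw [hg] at this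
    simpa [hg1] using this
  have hsg : s * g = 1 := by
    have := HopfAlgebra.mul_antipode_rTensor_comul_apply (R := k) g
    rw [hg] at this
    simpa [hg1] using this
  have hs : Coalgebra.comul (R := k) s = s ⊗ₜ[k] s := by
    have h1 : Coalgebra.comul (R := k) s * (g ⊗ₜ[k] g) = 1 := by
      rw [← hg, ← Bialgebra.comul_mul, hsg, Bialgebra.comul_one]
    have h2 : (g ⊗ₜ[k] g) * (s ⊗ₜ[k] s) = 1 := by
      rw [Algebra.TensorProduct.tmul_mul_tmul, hgs]; rfl
    exact left_inv_eq_right_inv h1 h2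
  let u : ι → H := fun j => W.symm (Pi.single j (Matrix.single ⟨0, hd j⟩ ⟨0, hd j⟩ 1))
  have hu : ∀ i j, χ i (u j) = if i = j then 1 else 0 := by
    intro i j
    rw [hχa]
    by_cases h : i = j
    · subst h; simp [u]
    · simp [u, h]
  let z : Module.Dual k H := ∑ i, χ i s • χ i
  have hz : ∀ b, z b = biTrace k H s b := fun b => by
    rw [ht]; simp [z]
  have hub : ∀ j b, biTrace k H (u j) b = χ j b := fun j b => by
    rw [ht]; simp [hu]
  have key : ∀ j, conv k H (χ j) z = χ j g • z := by
    intro j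
    ext b
    have h := biTrace_comul k H g s (u j) b hs hgs
    rw [hub, ← hz] at h
    rw [LinearMap.smul_apply, smul_eq_mul, ← h]
    obtain R := Coalgebra.Repr.arbitrary k b
    rw [conv, LinearMap.comp_apply, LinearMap.comp_apply, ← R.eq, biTrace_sum]
    simp [biTrace_tmul, hub, hz]
  have hzr : z ∈ LinearMap.range Φ := by
    rw [hΦrange]
    exact Submodule.sum_mem _ fun i _ => Submodule.smul_mem _ _
      (Submodule.subset_span ⟨i, rfl⟩)
  obtain ⟨ζ, hζ⟩ := hzr
  have key2 : ∀ x ∈ Submodule.span k (Set.range χ), conv k H x z = x g • z := by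
    intro x hx
    induction hx using Submodule.span_induction with
    | mem x h => obtain ⟨j, rfl⟩ := h; exact key j
    | zero => ext b; simp [conv]
    | add x y _ _ hx hy =>
      rw [LinearMap.add_apply, add_smul, ← hx, ← hy]
      ext b; simp [conv, TensorProduct.map_add_left]
    | smul c x _ hx =>
      rw [LinearMap.smul_apply, smul_assoc, ← hx]
      ext b; simp [conv, TensorProduct.map_smul_left]
  have key3 : ∀ y : RH, y * ζ = (Φ y g) • ζ := by
    intro y
    apply hΦinj
    rw [hΦmul, map_smul, hζ]
    exact key2 _ (hΦrange ▸ LinearMap.mem_range_self Φ y)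
  intro h0
  have hzg : z g = 0 := by
    rw [← h0]
    simp [z, s, hst]
  have hζ0 : ζ = 0 := by
    obtain ⟨K, hK⟩ := exists_isCompl (Submodule.span RH {ζ})
    have h1 : (1 : RH) ∈ Submodule.span RH {ζ} ⊔ K := by rw [hK.sup_eq_top]; trivial
    obtain ⟨j, hj, m, hm, hjm⟩ := Submodule.mem_sup.mp h1
    obtain ⟨r, rfl⟩ := Submodule.mem_span_singleton.mp hj
    have hζj : ζ * (r • ζ) = 0 := by
      rw [smul_eq_mul, key3 r, mul_smul_comm, key3 ζ, hζ, hzg]; simp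
    have hζm : ζ * m = ζ := by
      have := congrArg (ζ * ·) hjm
      simpa only [mul_add, hζj, zero_add, mul_one] using this
    have hmem : ζ ∈ K := by
      rw [← hζm]; exact K.smul_mem ζ hm
    exact (Submodule.disjoint_def.mp hK.disjoint) ζ (Submodule.mem_span_singleton_self ζ) hmem
  have hz0 : z = 0 := by rw [← hζ, hζ0, map_zero]
  have hχs : ∀ j, χ j s = 0 := by
    intro j
    have : z (u j) = 0 := by rw [hz0]; rfl
    simpa [z, hu] using this
  have hall : ∀ x ∈ Submodule.span k (Set.range χ), x s = 0 := by
    intro x hx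
    induction hx using Submodule.span_induction with
    | mem x h => obtain ⟨j, rfl⟩ := h; exact hχs j
    | zero => rfl
    | add x y _ _ hx hy => simp [hx, hy]
    | smul c x _ hx => simp [hx]
  have hε : Coalgebra.counit (R := k) s = 0 :=
    hall _ (hΦrange ▸ hΦone ▸ LinearMap.mem_range_self Φ 1)
  have := congrArg (Coalgebra.counit (R := k)) hgs
  rw [Bialgebra.counit_mul, hε, Bialgebra.counit_one, mul_zero] at this
  exact zero_ne_one this
end
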